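/- arXiv:1511.05278 — 2 statements merged into one kernel-verified Lean document; each statement's English description precedes it below -/
import Mathlib

section
/- (Analytic construction of solutions of the Diophantine equation x² + y³ = z¹¹.) For every z in the upper half-plane ℍ, writing Φ_j = Φ_j(x(z)) where x(z) = (x₁(z),...,x₆(z)) is the vector of eta-multiplied theta constants of order 13, the following three identities hold: Φ₄₄³ − Φ₁₂⁸·Φ₁₈² = 1728·Φ₁₂¹¹; Φ₄₄³ − Φ₁₂⁶·Φ₃₀² = 1728·Φ₁₂¹¹; Φ₄₄³ − Φ₁₂⁴·Φ₄₂² = 1728·Φ₁₂¹¹. -/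
noncomputable section

open Complex

def ζ : ℂ := Complex.exp (2 * Real.pi * Complex.I / 13)

def AA0 (v : Fin 6 → ℂ) : ℂ := v 0 * v 3 + v 1 * v 4 + v 2 * v 5
def AA1 (v : Fin 6 → ℂ) : ℂ := (v 0) ^ 2 - 2 * v 2 * v 3
def AA2 (v : Fin 6 → ℂ) : ℂ := -(v 4) ^ 2 - 2 * v 1 * v 3
def AA3 (v : Fin 6 → ℂ) : ℂ := (v 1) ^ 2 - 2 * v 0 * v 4
def AA4 (v : Fin 6 → ℂ) : ℂ := (v 2) ^ 2 - 2 * v 1 * v 5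
def AA5 (v : Fin 6 → ℂ) : ℂ := -(v 3) ^ 2 - 2 * v 0 * v 5
def AA6 (v : Fin 6 → ℂ) : ℂ := -(v 5) ^ 2 - 2 * v 2 * v 4

def DD0 (v : Fin 6 → ℂ) : ℂ := v 0 * v 1 * v 2
def DD1 (v : Fin 6 → ℂ) : ℂ := 2 * v 1 * (v 2) ^ 2 + (v 1) ^ 2 * v 5 - (v 3) ^ 2 * v 4 + v 0 * v 4 * v 5
def DD2 (v : Fin 6 → ℂ) : ℂ := -(v 5) ^ 3 + (v 1) ^ 2 * v 3 - 2 * v 1 * (v 4) ^ 2 + v 0 * v 3 * v 4 + 3 * v 2 * v 4 * v 5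
def DD3 (v : Fin 6 → ℂ) : ℂ := 2 * v 0 * (v 1) ^ 2 + (v 0) ^ 2 * v 4 - v 3 * (v 5) ^ 2 + v 2 * v 3 * v 4
def DD4 (v : Fin 6 → ℂ) : ℂ := -(v 1) ^ 2 * v 2 + v 0 * (v 5) ^ 2 - 2 * (v 3) ^ 2 * v 5 - v 0 * v 2 * v 4
def DD5 (v : Fin 6 → ℂ) : ℂ := -(v 3) ^ 3 + (v 2) ^ 2 * v 4 - 2 * v 2 * (v 5) ^ 2 + v 1 * v 4 * v 5 + 3 * v 0 * v 3 * v 5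
def DD6 (v : Fin 6 → ℂ) : ℂ := -(v 4) ^ 3 + (v 0) ^ 2 * v 5 - 2 * v 0 * (v 3) ^ 2 + v 2 * v 3 * v 5 + 3 * v 1 * v 3 * v 4
def DD7 (v : Fin 6 → ℂ) : ℂ := -(v 1) ^ 3 + v 2 * (v 3) ^ 2 - v 0 * v 2 * v 5 - 3 * v 0 * v 1 * v 4 + 2 * (v 0) ^ 2 * v 3
def DD8 (v : Fin 6 → ℂ) : ℂ := -(v 0) ^ 3 + v 1 * (v 5) ^ 2 - v 1 * v 2 * v 4 - 3 * v 0 * v 2 * v 3 + 2 * (v 2) ^ 2 * v 5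
def DD9 (v : Fin 6 → ℂ) : ℂ := 2 * (v 0) ^ 2 * v 2 + (v 2) ^ 2 * v 3 - (v 4) ^ 2 * v 5 + v 1 * v 3 * v 5
def DD10 (v : Fin 6 → ℂ) : ℂ := -(v 0) * (v 2) ^ 2 + v 1 * (v 3) ^ 2 - 2 * v 3 * (v 4) ^ 2 - v 0 * v 1 * v 5
def DD11 (v : Fin 6 → ℂ) : ℂ := -(v 2) ^ 3 + v 0 * (v 4) ^ 2 - v 0 * v 1 * v 3 - 3 * v 1 * v 2 * v 5 + 2 * (v 1) ^ 2 * v 4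
def DD12 (v : Fin 6 → ℂ) : ℂ := -(v 0) ^ 2 * v 1 + v 2 * (v 4) ^ 2 - 2 * v 4 * (v 5) ^ 2 - v 1 * v 2 * v 3
def DDinf (v : Fin 6 → ℂ) : ℂ := v 3 * v 4 * v 5

def GG0 (v : Fin 6 → ℂ) : ℂ := (DD0 v) ^ 2 + (DDinf v) ^ 2
def GG1 (v : Fin 6 → ℂ) : ℂ := -(DD7 v) ^ 2 + 2 * DD0 v * DD1 v + 10 * DDinf v * DD1 v + 2 * DD2 v * DD12 v - 2 * DD3 v * DD11 v - 4 * DD4 v * DD10 v - 2 * DD9 v * DD5 v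
def GG2 (v : Fin 6 → ℂ) : ℂ := -2 * (DD1 v) ^ 2 - 4 * DD0 v * DD2 v + 6 * DDinf v * DD2 v - 2 * DD4 v * DD11 v + 2 * DD5 v * DD10 v - 2 * DD6 v * DD9 v - 2 * DD7 v * DD8 v
def GG3 (v : Fin 6 → ℂ) : ℂ := -(DD8 v) ^ 2 + 2 * DD0 v * DD3 v + 10 * DDinf v * DD3 v + 2 * DD6 v * DD10 v - 2 * DD9 v * DD7 v - 4 * DD12 v * DD4 v - 2 * DD1 v * DD2 v
def GG4 (v : Fin 6 → ℂ) : ℂ := -(DD2 v) ^ 2 + 10 * DD0 v * DD4 v - 2 * DDinf v * DD4 v + 2 * DD5 v * DD12 v - 2 * DD9 v * DD8 v - 4 * DD1 v * DD3 v - 2 * DD10 v * DD7 v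
def GG5 (v : Fin 6 → ℂ) : ℂ := -2 * (DD9 v) ^ 2 - 4 * DD0 v * DD5 v + 6 * DDinf v * DD5 v - 2 * DD10 v * DD8 v + 2 * DD6 v * DD12 v - 2 * DD2 v * DD3 v - 2 * DD11 v * DD7 v
def GG6 (v : Fin 6 → ℂ) : ℂ := -2 * (DD3 v) ^ 2 - 4 * DD0 v * DD6 v + 6 * DDinf v * DD6 v - 2 * DD12 v * DD7 v + 2 * DD2 v * DD4 v - 2 * DD5 v * DD1 v - 2 * DD8 v * DD11 v
def GG7 (v : Fin 6 → ℂ) : ℂ := -2 * (DD10 v) ^ 2 + 6 * DD0 v * DD7 v + 4 * DDinf v * DD7 v - 2 * DD1 v * DD6 v - 2 * DD2 v * DD5 v - 2 * DD8 v * DD12 v - 2 * DD9 v * DD11 v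
def GG8 (v : Fin 6 → ℂ) : ℂ := -2 * (DD4 v) ^ 2 + 6 * DD0 v * DD8 v + 4 * DDinf v * DD8 v - 2 * DD3 v * DD5 v - 2 * DD6 v * DD2 v - 2 * DD11 v * DD10 v - 2 * DD1 v * DD7 v
def GG9 (v : Fin 6 → ℂ) : ℂ := -(DD11 v) ^ 2 + 2 * DD0 v * DD9 v + 10 * DDinf v * DD9 v + 2 * DD5 v * DD4 v - 2 * DD1 v * DD8 v - 4 * DD10 v * DD12 v - 2 * DD3 v * DD6 v
def GG10 (v : Fin 6 → ℂ) : ℂ := -(DD5 v) ^ 2 + 10 * DD0 v * DD10 v - 2 * DDinf v * DD10 v + 2 * DD6 v * DD4 v - 2 * DD3 v * DD7 v - 4 * DD9 v * DD1 v - 2 * DD12 v * DD11 v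
def GG11 (v : Fin 6 → ℂ) : ℂ := -2 * (DD12 v) ^ 2 + 6 * DD0 v * DD11 v + 4 * DDinf v * DD11 v - 2 * DD9 v * DD2 v - 2 * DD5 v * DD6 v - 2 * DD7 v * DD4 v - 2 * DD3 v * DD8 v
def GG12 (v : Fin 6 → ℂ) : ℂ := -(DD6 v) ^ 2 + 10 * DD0 v * DD12 v - 2 * DDinf v * DD12 v + 2 * DD2 v * DD10 v - 2 * DD1 v * DD11 v - 4 * DD3 v * DD9 v - 2 * DD4 v * DD8 v

def wInf (v : Fin 6 → ℂ) : ℂ := 13 * (AA0 v) ^ 2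
def wF (ν : ℕ) (v : Fin 6 → ℂ) : ℂ :=
  (AA0 v + ζ ^ ν * AA1 v + ζ ^ (4 * ν) * AA2 v + ζ ^ (9 * ν) * AA3 v + ζ ^ (3 * ν) * AA4 v
    + ζ ^ (12 * ν) * AA5 v + ζ ^ (10 * ν) * AA6 v) ^ 2
def dInf (v : Fin 6 → ℂ) : ℂ := 13 ^ 2 * GG0 v
def dF (ν : ℕ) (v : Fin 6 → ℂ) : ℂ :=
  -13 * GG0 v + ζ ^ ν * GG1 v + ζ ^ (2 * ν) * GG2 v + ζ ^ (3 * ν) * GG3 v + ζ ^ (4 * ν) * GG4 v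
    + ζ ^ (5 * ν) * GG5 v + ζ ^ (6 * ν) * GG6 v + ζ ^ (7 * ν) * GG7 v + ζ ^ (8 * ν) * GG8 v
    + ζ ^ (9 * ν) * GG9 v + ζ ^ (10 * ν) * GG10 v + ζ ^ (11 * ν) * GG11 v + ζ ^ (12 * ν) * GG12 v

def Phi12 (v : Fin 6 → ℂ) : ℂ :=
  -(1 / (13 * 52) : ℂ) * ((∑ ν ∈ Finset.range 13, (dF ν v) ^ 2) + (dInf v) ^ 2)
def Phi18 (v : Fin 6 → ℂ) : ℂ :=
  (1 / (13 * 6) : ℂ) * ((∑ ν ∈ Finset.range 13, (dF ν v) ^ 3) + (dInf v) ^ 3)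
def Phi30 (v : Fin 6 → ℂ) : ℂ :=
  -(1 / (13 * 1315) : ℂ) * ((∑ ν ∈ Finset.range 13, (dF ν v) ^ 5) + (dInf v) ^ 5)
def Phi42 (v : Fin 6 → ℂ) : ℂ :=
  (1 / (13 * 226842) : ℂ) * ((∑ ν ∈ Finset.range 13, (dF ν v) ^ 7) + (dInf v) ^ 7)

def Phi20 (v : Fin 6 → ℂ) : ℂ :=
  (1 / (13 * 25) : ℂ) * ((∑ ν ∈ Finset.range 13, (wF ν v) ^ 5) + (wInf v) ^ 5)
def Phi32 (v : Fin 6 → ℂ) : ℂ :=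
  -(1 / (13 * 1840) : ℂ) * ((∑ ν ∈ Finset.range 13, (wF ν v) ^ 8) + (wInf v) ^ 8)
def Phi44 (v : Fin 6 → ℂ) : ℂ :=
  (1 / (13 * 146905) : ℂ) * ((∑ ν ∈ Finset.range 13, (wF ν v) ^ 11) + (wInf v) ^ 11)

def th13 (c : ℚ) (k : ℤ) (z : ℂ) : ℂ :=
  Complex.exp (2 * Real.pi * Complex.I * (c : ℂ) * z) *
    ∑' n : ℤ, (-1 : ℂ) ^ n *
      Complex.exp (2 * Real.pi * Complex.I * (((13 * n ^ 2 + k * n : ℤ) : ℂ) / 2) * z)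

def ta : Fin 6 → ℂ → ℂ :=
  ![th13 (121 / 104) 11, th13 (49 / 104) 7, th13 (25 / 104) 5,
    fun z => -th13 (9 / 104) 3 z, th13 (81 / 104) 9, th13 (1 / 104) 1]

def AV (z : ℂ) : Fin 6 → ℂ := fun i => ta i z

def etaF (z : ℂ) : ℂ :=
  Complex.exp (2 * Real.pi * Complex.I * z / 24) *
    ∏' n : ℕ, (1 - Complex.exp (2 * Real.pi * Complex.I * z) ^ (n + 1))

def xV (z : ℂ) : Fin 6 → ℂ := fun i => etaF z * ta i z

def Δfun (z : ℂ) : ℂ := (etaF z) ^ 24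

def Eis (k : ℕ) (z : ℂ) : ℂ :=
  (1 / 2 : ℂ) * ∑' p : {p : ℤ × ℤ // Int.gcd p.1 p.2 = 1},
    1 / ((p.val.1 : ℂ) * z + (p.val.2 : ℂ)) ^ k

/-- The odd function on `ZMod 13` attached to a vector of `ℂ⁶`, in the coordinates for which the
order 13 theta constants form a Weil representation. -/
def oddExt (v : Fin 6 → ℂ) : ZMod 13 → ℂ :=
  ![0, v 0, -v 4, v 1, -v 2, -v 3, -v 5, v 5, v 3, v 2, -v 1, v 4, -v 0]

/-- The vector of `ℂ⁶` read off from a function on `ZMod 13`; a left inverse of `oddExt`. -/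
def toVec (φ : ZMod 13 → ℂ) : Fin 6 → ℂ := ![φ 1, φ 3, -φ 4, -φ 5, -φ 2, -φ 6]

/-- The additive character `a ↦ ζ ^ a` of `ZMod 13`. -/
def e13 : AddChar (ZMod 13) ℂ := ZMod.stdAddChar

/-- The Fourier transform on `ZMod 13`. -/
def fourier13 (φ : ZMod 13 → ℂ) (b : ZMod 13) : ℂ := ∑ a, e13 (a * b) * φ a

/-- The action of the `μ`-th power of the translation `z ↦ z + 1`. -/
def twist13 (μ : ZMod 13) (φ : ZMod 13 → ℂ) (a : ZMod 13) : ℂ := e13 (7 * μ * a ^ 2) * φ a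

/-- The quadratic Gauss sum of `ZMod 13` attached to `μ`. -/
def gauss13 (μ : ZMod 13) : ℂ := ∑ b, e13 (7 * μ * b ^ 2)

lemma toVec_oddExt (v : Fin 6 → ℂ) : toVec (oddExt v) = v := by
  ext i; fin_cases i <;> simp [toVec, oddExt]

lemma oddExt_neg (v : Fin 6 → ℂ) (a : ZMod 13) : oddExt v (-a) = -oddExt v a := by
  fin_cases a <;> simp [oddExt]
  rfl

lemma oddExt_toVec {φ : ZMod 13 → ℂ} (hφ : ∀ a, φ (-a) = -φ a) : oddExt (toVec φ) = φ := by
  have h0 : φ 0 = 0 := by simpa [self_eq_neg] using hφ 0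
  ext a
  fin_cases a
  · exact h0.symm
  · rfl
  · exact neg_neg _
  · rfl
  · exact neg_neg _
  · exact neg_neg _
  · exact neg_neg _
  all_goals exact (hφ _).symm

lemma e13_eq_pow (n : ℕ) : e13 n = ζ ^ n := by
  have := ZMod.stdAddChar_coe (N := 13) n
  simp only [e13, ζ, ← Complex.exp_nat_mul]
  push_cast at this
  rw [this]; congr 1; ring

lemma sum_e13_mul (b : ZMod 13) : ∑ a, e13 (a * b) = if b = 0 then 13 else 0 := by
  have := AddChar.sum_mulShift b (ZMod.isPrimitive_stdAddChar 13)
  simpa [e13] using this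

lemma fourier13_neg {φ : ZMod 13 → ℂ} (hφ : ∀ a, φ (-a) = -φ a) (b : ZMod 13) :
    fourier13 φ (-b) = -fourier13 φ b := by
  rw [fourier13, ← Equiv.sum_comp (Equiv.neg (ZMod 13))]
  simp [fourier13, hφ]

lemma fourier13_fourier13 (φ : ZMod 13 → ℂ) (c : ZMod 13) :
    fourier13 (fourier13 φ) c = 13 * φ (-c) := by
  simp only [fourier13, Finset.mul_sum]
  rw [Finset.sum_comm]
  have h (a : ZMod 13) : ∑ b, e13 (b * c) * (e13 (a * b) * φ a)
      = (if c + a = 0 then 13 else 0) * φ a := by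
    rw [← sum_e13_mul, Finset.sum_mul]
    refine Finset.sum_congr rfl fun b _ ↦ ?_
    rw [mul_add, AddChar.map_add_eq_mul, mul_comm a b, mul_assoc]
  simp only [h, ite_mul, zero_mul, add_eq_zero_iff_eq_neg', Finset.sum_ite_eq', Finset.mem_univ,
    if_true]

/-- The relation `S Tᵘ S = T⁻¹ᐟᵘ S T⁻¹ᐟᵘ` of the Weil representation. -/
lemma fourier13_twist13_fourier13 {μ u : ZMod 13} (hu : μ * u = 1) (φ : ZMod 13 → ℂ)
    (c : ZMod 13) :
    fourier13 (twist13 μ (fourier13 φ)) c =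
      gauss13 μ * twist13 (-u) (fun x ↦ fourier13 (twist13 (-u) φ) (-u * x)) c := by
  simp only [fourier13, twist13, Finset.mul_sum]
  rw [Finset.sum_comm]
  refine Finset.sum_congr rfl fun a _ ↦ ?_
  have h13 : (13 : ZMod 13) = 0 := rfl
  rw [gauss13, ← Equiv.sum_comp (Equiv.addRight (-(u * (a + c)))), Finset.sum_mul]
  refine Finset.sum_congr rfl fun b _ ↦ ?_
  simp only [← mul_assoc, ← AddChar.map_add_eq_mul]
  congr 2
  simp only [Equiv.coe_addRight]
  linear_combination (-(14 * b * (a + c)) + 7 * u * (a + c) ^ 2) * hu +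
    (-(b * (a + c)) + u * (a + c) ^ 2 - u * a * c) * h13

lemma zeta_pow_thirteen : ζ ^ 13 = 1 := by
  rw [← e13_eq_pow]; exact AddChar.map_zero_eq_one _

lemma geom_sum_zeta : ∑ i ∈ Finset.range 13, ζ ^ i = 0 := by
  have := sum_e13_mul 1
  rw [if_neg (by decide)] at this
  rw [← this, Finset.sum_range]
  refine Finset.sum_congr rfl fun i _ ↦ ?_
  rw [← e13_eq_pow]
  congr 1
  fin_cases i <;> rfl

lemma gauss13_sq {μ : ZMod 13} (hμ : μ ≠ 0) : gauss13 μ ^ 2 = 13 := by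
  have : Fact (Nat.Prime 13) := ⟨by norm_num⟩
  have h13 : (13 : ZMod 13) = 0 := rfl
  let f : ZMod 13 ≃ ZMod 13 :=
    ⟨(5 * ·), (8 * ·), fun x ↦ by linear_combination 3 * x * h13,
      fun x ↦ by linear_combination 3 * x * h13⟩
  have h : gauss13 μ = ∑ c, e13 (-(7 * μ * c ^ 2)) := by
    rw [gauss13, ← Equiv.sum_comp f]
    refine Finset.sum_congr rfl fun c _ ↦ ?_
    congr 1
    change 7 * μ * (5 * c) ^ 2 = _
    linear_combination 14 * μ * c ^ 2 * h13
  rw [sq]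
  nth_rewrite 2 [h]
  rw [gauss13, Finset.sum_mul_sum, Finset.sum_comm]
  have h2 (c : ZMod 13) : ∑ b, e13 (7 * μ * b ^ 2) * e13 (-(7 * μ * c ^ 2)) =
      ∑ d, e13 (7 * μ * d ^ 2) * e13 (c * (μ * d)) := by
    rw [← Equiv.sum_comp (Equiv.addRight c)]
    refine Finset.sum_congr rfl fun d _ ↦ ?_
    rw [← AddChar.map_add_eq_mul, ← AddChar.map_add_eq_mul]
    congr 1
    simp only [Equiv.coe_addRight]
    linear_combination c * μ * d * h13
  simp only [h2]
  rw [Finset.sum_comm]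
  simp only [← Finset.mul_sum, sum_e13_mul, mul_eq_zero, hμ, false_or, mul_ite, mul_zero,
    Finset.sum_ite_eq', Finset.mem_univ, if_true]
  simp

/-- The convolution rule for products of Fourier sums. -/
lemma sum_e13_mul_sum_e13 (A B : ZMod 13 → ℂ) :
    (∑ i, e13 i * A i) * ∑ j, e13 j * B j = ∑ k, e13 k * ∑ i, A i * B (k - i) := by
  simp only [Finset.sum_mul, Finset.mul_sum]
  rw [Finset.sum_comm (γ := ZMod 13)]
  conv_rhs => rw [Finset.sum_comm]
  refine Finset.sum_congr rfl fun i _ ↦ ?_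
  conv_rhs => rw [← Equiv.sum_comp (Equiv.addRight i)]
  refine Finset.sum_congr rfl fun k _ ↦ ?_
  simp only [Equiv.coe_addRight, add_sub_cancel_right, AddChar.map_add_eq_mul]
  ring

lemma fourier13_eq_sum (φ : ZMod 13 → ℂ) {u w : ZMod 13} (h : u * w = 1) :
    fourier13 φ u = ∑ k, e13 k * φ (w * k) := by
  let f : ZMod 13 ≃ ZMod 13 :=
    ⟨(u * ·), (w * ·), fun x ↦ by linear_combination x * h, fun x ↦ by linear_combination x * h⟩
  rw [← Equiv.sum_comp f]
  refine Finset.sum_congr rfl fun a _ ↦ ?_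
  change _ = e13 (u * a) * φ (w * (u * a))
  congr 2
  · ring
  · linear_combination -a * h

/-- The function of `k` whose Fourier sum is `φ̂ u₁ * φ̂ u₂ * φ̂ u₃`, where `wᵢ` is the inverse
of `uᵢ`. -/
def conv3 (φ : ZMod 13 → ℂ) (w₁ w₂ w₃ : ZMod 13) (k : ZMod 13) : ℂ :=
  ∑ i, (∑ j, φ (w₁ * j) * φ (w₂ * (i - j))) * φ (w₃ * (k - i))

lemma fourier13_mul_mul (φ : ZMod 13 → ℂ) {u₁ u₂ u₃ w₁ w₂ w₃ : ZMod 13}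
    (h₁ : u₁ * w₁ = 1) (h₂ : u₂ * w₂ = 1) (h₃ : u₃ * w₃ = 1) :
    fourier13 φ u₁ * fourier13 φ u₂ * fourier13 φ u₃ = ∑ k, e13 k * conv3 φ w₁ w₂ w₃ k := by
  rw [fourier13_eq_sum φ h₁, fourier13_eq_sum φ h₂, fourier13_eq_sum φ h₃, sum_e13_mul_sum_e13,
    sum_e13_mul_sum_e13]
  rfl

lemma sum_zmod13 {M : Type*} [AddCommMonoid M] (f : ZMod 13 → M) :
    ∑ i, f i = f 0 + f 1 + f 2 + f 3 + f 4 + f 5 + f 6 + f 7 + f 8 + f 9 + f 10 + f 11 + f 12 :=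
  (Fin.sum_univ_castSucc f).trans (by simp [Fin.sum_univ_castSucc]; rfl)

lemma oddExt_values (v : Fin 6 → ℂ) : oddExt v 0 = 0 ∧ oddExt v 1 = v 0 ∧ oddExt v 2 = -v 4 ∧
    oddExt v 3 = v 1 ∧ oddExt v 4 = -v 2 ∧ oddExt v 5 = -v 3 ∧ oddExt v 6 = -v 5 ∧
    oddExt v 7 = v 5 ∧ oddExt v 8 = v 3 ∧ oddExt v 9 = v 2 ∧ oddExt v 10 = -v 1 ∧
    oddExt v 11 = v 4 ∧ oddExt v 12 = -v 0 := by
  refine ⟨?_, ?_, ?_, ?_, ?_, ?_, ?_, ?_, ?_, ?_, ?_, ?_, ?_⟩ <;> rfl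

/-- The cubic form which is, up to sign, the coefficient of `ζ ^ 1`, `ζ ^ 3`, `ζ ^ 4`, … in the
Fourier transforms of `DD0` and `DDinf`. -/
def quarticX (v : Fin 6 → ℂ) : ℂ :=
  -2 * DD0 v - DD1 v - DD2 v - DD3 v + DD4 v - DD5 v - DD6 v - DD9 v + DD10 v + DD12 v
    + 3 * DDinf v

/-- The cubic form which is, up to sign, the coefficient of `ζ ^ 2`, `ζ ^ 5`, `ζ ^ 6`, … in the
Fourier transforms of `DD0` and `DDinf`. -/
def quarticY (v : Fin 6 → ℂ) : ℂ :=
  3 * DD0 v - DD1 v - DD3 v - DD4 v - DD7 v - DD8 v - DD9 v - DD10 v - DD11 v - DD12 v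
    + 2 * DDinf v

lemma conv3_one_nine_ten (v : Fin 6 → ℂ) :
    conv3 (oddExt v) 1 9 10 0 = 0 ∧
    conv3 (oddExt v) 1 9 10 1 = -quarticX v ∧
    conv3 (oddExt v) 1 9 10 2 = -quarticY v ∧
    conv3 (oddExt v) 1 9 10 3 = -quarticX v ∧
    conv3 (oddExt v) 1 9 10 4 = quarticX v ∧
    conv3 (oddExt v) 1 9 10 5 = -quarticY v ∧
    conv3 (oddExt v) 1 9 10 6 = -quarticY v ∧
    conv3 (oddExt v) 1 9 10 7 = quarticY v ∧
    conv3 (oddExt v) 1 9 10 8 = quarticY v ∧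
    conv3 (oddExt v) 1 9 10 9 = -quarticX v ∧
    conv3 (oddExt v) 1 9 10 10 = quarticX v ∧
    conv3 (oddExt v) 1 9 10 11 = quarticY v ∧
    conv3 (oddExt v) 1 9 10 12 = quarticX v := by
  obtain ⟨h0, h1, h2, h3, h4, h5, h6, h7, h8, h9, h10, h11, h12⟩ := oddExt_values v
  generalize oddExt v = u at *
  refine ⟨?_, ?_, ?_, ?_, ?_, ?_, ?_, ?_, ?_, ?_, ?_, ?_, ?_⟩ <;>
  · simp only [conv3, sum_zmod13]
    reduce_mod_char
    simp only [h0, h1, h2, h3, h4, h5, h6, h7, h8, h9, h10, h11, h12, quarticX, quarticY, DD0, DD1,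
      DD2, DD3, DD4, DD5, DD6, DD7, DD8, DD9, DD10, DD11, DD12, DDinf]
    ring

lemma e13_values : e13 1 = ζ ∧ e13 2 = ζ ^ 2 ∧ e13 3 = ζ ^ 3 ∧ e13 4 = ζ ^ 4 ∧ e13 5 = ζ ^ 5 ∧
    e13 6 = ζ ^ 6 ∧ e13 7 = ζ ^ 7 ∧ e13 8 = ζ ^ 8 ∧ e13 9 = ζ ^ 9 ∧ e13 10 = ζ ^ 10 ∧
    e13 11 = ζ ^ 11 ∧ e13 12 = ζ ^ 12 := by
  simp only [← e13_eq_pow]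
  exact ⟨by simpa using e13_eq_pow 1, rfl, rfl, rfl, rfl, rfl, rfl, rfl, rfl, rfl, rfl, rfl⟩

lemma conv3_dilate (φ : ZMod 13 → ℂ) (w₁ w₂ w₃ k : ZMod 13) {u u' : ZMod 13} (h : u * u' = 1) :
    conv3 φ (w₁ * u) (w₂ * u) (w₃ * u) k = conv3 φ w₁ w₂ w₃ (u * k) := by
  let f : ZMod 13 ≃ ZMod 13 :=
    ⟨(u * ·), (u' * ·), fun x ↦ by linear_combination x * h, fun x ↦ by linear_combination x * h⟩
  rw [conv3, conv3]
  conv_rhs => rw [← Equiv.sum_comp f]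
  refine Finset.sum_congr rfl fun i _ ↦ ?_
  conv_rhs => rw [← Equiv.sum_comp f]
  simp only [f, Equiv.coe_fn_mk, mul_assoc, mul_sub]

/-- `ζ + ζ³ + ζ⁹ - ζ⁴ - ζ¹² - ζ¹⁰`, a quartic Gauss period. -/
def periodA : ℂ := ζ + ζ ^ 3 + ζ ^ 9 - ζ ^ 4 - ζ ^ 10 - ζ ^ 12

/-- `ζ² + ζ⁵ + ζ⁶ - ζ⁷ - ζ⁸ - ζ¹¹`, a quartic Gauss period. -/
def periodB : ℂ := ζ ^ 2 + ζ ^ 5 + ζ ^ 6 - ζ ^ 7 - ζ ^ 8 - ζ ^ 11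

lemma periodA_sq_add_periodB_sq : periodA ^ 2 + periodB ^ 2 = -13 := by
  have h1 := geom_sum_zeta
  have h13 := zeta_pow_thirteen
  simp only [Finset.sum_range_succ, Finset.sum_range_zero] at h1
  simp only [periodA, periodB]
  linear_combination ((-12 + ζ + ζ ^ 3 - 2 * ζ ^ 4 + 3 * ζ ^ 5 + ζ ^ 7 - 2 * ζ ^ 8 + 3 * ζ ^ 9 +
    ζ ^ 11) * h13 + h1)

lemma DD0_toVec_fourier13 (v : Fin 6 → ℂ) :
    DD0 (toVec (fourier13 (oddExt v))) = periodA * quarticX v + periodB * quarticY v := by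
  obtain ⟨h0, h1, h2, h3, h4, h5, h6, h7, h8, h9, h10, h11, h12⟩ := conv3_one_nine_ten v
  obtain ⟨e1, e2, e3, e4, e5, e6, e7, e8, e9, e10, e11, e12⟩ := e13_values
  have h := fourier13_mul_mul (oddExt v) (u₁ := 1) (u₂ := 3) (u₃ := 4) (w₁ := 1) (w₂ := 9)
    (w₃ := 10) (by decide) (by decide) (by decide)
  simp only [sum_zmod13, h0, h1, h2, h3, h4, h5, h6, h7, h8, h9, h10, h11, h12, e1, e2, e3, e4,
    e5, e6, e7, e8, e9, e10, e11, e12] at h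
  simp only [DD0, toVec, periodA, periodB]
  simp only [Matrix.cons_val]
  linear_combination -h

lemma DDinf_toVec_fourier13 (v : Fin 6 → ℂ) :
    DDinf (toVec (fourier13 (oddExt v))) = periodA * quarticY v - periodB * quarticX v := by
  obtain ⟨h0, h1, h2, h3, h4, h5, h6, h7, h8, h9, h10, h11, h12⟩ := conv3_one_nine_ten v
  have h := fourier13_mul_mul (oddExt v) (u₁ := 2) (u₂ := 6) (u₃ := 8) (w₁ := 1 * 7) (w₂ := 9 * 7)
    (w₃ := 10 * 7) (by decide) (by decide) (by decide)
  simp only [sum_zmod13, conv3_dilate _ _ _ _ _ (show (7 : ZMod 13) * 2 = 1 by decide)] at h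
  reduce_mod_char at h
  have h5' : fourier13 (oddExt v) 8 = - fourier13 (oddExt v) 5 := fourier13_neg (oddExt_neg v) 5
  obtain ⟨e1, e2, e3, e4, e5, e6, e7, e8, e9, e10, e11, e12⟩ := e13_values
  simp only [h5', h0, h1, h2, h3, h4, h5, h6, h7, h8, h9, h10, h11, h12, e1, e2, e3, e4, e5,
    e6, e7, e8, e9, e10, e11, e12] at h
  simp only [DDinf, toVec, periodA, periodB]
  simp only [Matrix.cons_val]
  linear_combination h

lemma quarticX_sq_add_quarticY_sq (v : Fin 6 → ℂ) :
    quarticX v ^ 2 + quarticY v ^ 2 = -dF 0 v := by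
  simp only [quarticX, quarticY, dF, GG0, GG1, GG2, GG3, GG4, GG5, GG6, GG7, GG8, GG9, GG10, GG11,
    GG12, mul_zero, pow_zero]
  ring

lemma dInf_toVec_fourier13 (v : Fin 6 → ℂ) :
    dInf (toVec (fourier13 (oddExt v))) = 13 ^ 3 * dF 0 v := by
  rw [dInf, GG0, DD0_toVec_fourier13, DDinf_toVec_fourier13]
  linear_combination 13 ^ 2 * (quarticX v ^ 2 + quarticY v ^ 2) * periodA_sq_add_periodB_sq -
    13 ^ 3 * quarticX_sq_add_quarticY_sq v

lemma fourier13_mul (φ : ZMod 13 → ℂ) {u₁ u₂ w₁ w₂ : ZMod 13} (h₁ : u₁ * w₁ = 1)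
    (h₂ : u₂ * w₂ = 1) :
    fourier13 φ u₁ * fourier13 φ u₂ = ∑ k, e13 k * ∑ i, φ (w₁ * i) * φ (w₂ * (k - i)) := by
  rw [fourier13_eq_sum φ h₁, fourier13_eq_sum φ h₂, sum_e13_mul_sum_e13]

lemma AA0_toVec_fourier13 (v : Fin 6 → ℂ) :
    AA0 (toVec (fourier13 (oddExt v))) =
      (ζ + ζ ^ 3 + ζ ^ 4 + ζ ^ 9 + ζ ^ 10 + ζ ^ 12 -
        (ζ ^ 2 + ζ ^ 5 + ζ ^ 6 + ζ ^ 7 + ζ ^ 8 + ζ ^ 11)) *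
      (AA0 v + AA1 v + AA2 v + AA3 v + AA4 v + AA5 v + AA6 v) := by
  obtain ⟨h0, h1, h2, h3, h4, h5, h6, h7, h8, h9, h10, h11, h12⟩ := oddExt_values v
  have h₁ := fourier13_mul (oddExt v) (u₁ := 1) (u₂ := 5) (w₁ := 1) (w₂ := 8) (by decide)
    (by decide)
  have h₂ := fourier13_mul (oddExt v) (u₁ := 3) (u₂ := 2) (w₁ := 9) (w₂ := 7) (by decide)
    (by decide)
  have h₃ := fourier13_mul (oddExt v) (u₁ := 4) (u₂ := 6) (w₁ := 10) (w₂ := 11) (by decide)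
    (by decide)
  simp only [AA0, toVec]
  generalize oddExt v = u at *
  simp only [sum_zmod13, mul_zero, one_mul] at h₁ h₂ h₃
  reduce_mod_char at h₁ h₂ h₃
  obtain ⟨e1, e2, e3, e4, e5, e6, e7, e8, e9, e10, e11, e12⟩ := e13_values
  simp only [h0, h1, h2, h3, h4, h5, h6, h7, h8, h9, h10, h11, h12, e1, e2, e3, e4, e5,
    e6, e7, e8, e9, e10, e11, e12] at h₁ h₂ h₃
  simp only [AA1, AA2, AA3, AA4, AA5, AA6]
  simp only [Matrix.cons_val]
  linear_combination h₃ - h₁ - h₂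

lemma wInf_toVec_fourier13 (v : Fin 6 → ℂ) :
    wInf (toVec (fourier13 (oddExt v))) = 13 ^ 2 * wF 0 v := by
  have h1 := geom_sum_zeta
  have h13 := zeta_pow_thirteen
  simp only [Finset.sum_range_succ, Finset.sum_range_zero] at h1
  rw [wInf, AA0_toVec_fourier13, wF]
  simp only [mul_zero, pow_zero, one_mul]
  linear_combination 13 * (AA0 v + AA1 v + AA2 v + AA3 v + AA4 v + AA5 v + AA6 v) ^ 2 *
    ((12 - ζ - 2 * ζ ^ 2 + ζ ^ 3 - 4 * ζ ^ 4 - ζ ^ 5 + 2 * ζ ^ 6 - 3 * ζ ^ 7 + 3 * ζ ^ 9 - 2 * ζ ^ 10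
      + ζ ^ 11) * h13 - h1)

/-- The action of `T ^ ν` on `ℂ⁶`, where `s = ζ ^ ν`. -/
def rescale (s : ℂ) (v : Fin 6 → ℂ) : Fin 6 → ℂ :=
  ![s ^ 7 * v 0, s ^ 11 * v 1, s ^ 8 * v 2, s ^ 6 * v 3, s ^ 2 * v 4, s ^ 5 * v 5]

lemma toVec_twist13_oddExt (ν : ℕ) (v : Fin 6 → ℂ) :
    toVec (twist13 ν (oddExt v)) = rescale (ζ ^ ν) v := by
  obtain ⟨-, h1, h2, h3, h4, h5, h6, -⟩ := oddExt_values v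
  have h (n m : ℕ) (a : ZMod 13) (ha : 7 * a ^ 2 = n) (h : m = n * ν) :
      e13 (7 * ν * a ^ 2) = ζ ^ m := by
    rw [h, ← e13_eq_pow]
    congr 1
    push_cast
    linear_combination (ν : ZMod 13) * ha
  simp only [toVec, twist13, rescale, h1, h2, h3, h4, h5, h6, ← pow_mul]
  rw [h 7 _ 1 rfl (mul_comm ..), h 11 _ 3 rfl (mul_comm ..), h 8 _ 4 rfl (mul_comm ..),
    h 6 _ 5 rfl (mul_comm ..), h 2 _ 2 rfl (mul_comm ..), h 5 _ 6 rfl (mul_comm ..)]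
  simp only [mul_neg, neg_neg]

lemma DD_rescale {s : ℂ} (hs : s ^ 13 = 1) (v : Fin 6 → ℂ) : DD0 (rescale s v) = DD0 v ∧
    DD1 (rescale s v) = s * DD1 v ∧ DD2 (rescale s v) = s ^ 2 * DD2 v ∧
    DD3 (rescale s v) = s ^ 3 * DD3 v ∧ DD4 (rescale s v) = s ^ 4 * DD4 v ∧
    DD5 (rescale s v) = s ^ 5 * DD5 v ∧ DD6 (rescale s v) = s ^ 6 * DD6 v ∧
    DD7 (rescale s v) = s ^ 7 * DD7 v ∧ DD8 (rescale s v) = s ^ 8 * DD8 v ∧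
    DD9 (rescale s v) = s ^ 9 * DD9 v ∧ DD10 (rescale s v) = s ^ 10 * DD10 v ∧
    DD11 (rescale s v) = s ^ 11 * DD11 v ∧ DD12 (rescale s v) = s ^ 12 * DD12 v ∧
    DDinf (rescale s v) = DDinf v := by
  simp only [rescale, DD0, DD1, DD2, DD3, DD4, DD5, DD6, DD7, DD8, DD9, DD10, DD11, DD12, DDinf,
    Matrix.cons_val]
  refine ⟨?_, ?_, ?_, ?_, ?_, ?_, ?_, ?_, ?_, ?_, ?_, ?_, ?_, ?_⟩ <;> grind

lemma AA_rescale {s : ℂ} (hs : s ^ 13 = 1) (v : Fin 6 → ℂ) : AA0 (rescale s v) = AA0 v ∧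
    AA1 (rescale s v) = s * AA1 v ∧ AA2 (rescale s v) = s ^ 4 * AA2 v ∧
    AA3 (rescale s v) = s ^ 9 * AA3 v ∧ AA4 (rescale s v) = s ^ 3 * AA4 v ∧
    AA5 (rescale s v) = s ^ 12 * AA5 v ∧ AA6 (rescale s v) = s ^ 10 * AA6 v := by
  simp only [rescale, AA0, AA1, AA2, AA3, AA4, AA5, AA6, Matrix.cons_val]
  refine ⟨?_, ?_, ?_, ?_, ?_, ?_, ?_⟩ <;> grind

lemma zeta_pow_pow_thirteen (ν : ℕ) : (ζ ^ ν) ^ 13 = 1 := by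
  rw [← pow_mul, mul_comm, pow_mul, zeta_pow_thirteen, one_pow]

lemma dInf_rescale {s : ℂ} (hs : s ^ 13 = 1) (v : Fin 6 → ℂ) :
    dInf (rescale s v) = dInf v := by
  obtain ⟨h0, -, -, -, -, -, -, -, -, -, -, -, -, hi⟩ := DD_rescale hs v
  simp only [dInf, GG0, h0, hi]

lemma wInf_rescale {s : ℂ} (hs : s ^ 13 = 1) (v : Fin 6 → ℂ) :
    wInf (rescale s v) = wInf v := by
  simp only [wInf, (AA_rescale hs v).1]

lemma wF_zero_rescale (ν : ℕ) (v : Fin 6 → ℂ) : wF 0 (rescale (ζ ^ ν) v) = wF ν v := by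
  obtain ⟨h0, h1, h2, h3, h4, h5, h6⟩ := AA_rescale (zeta_pow_pow_thirteen ν) v
  simp only [wF, h0, h1, h2, h3, h4, h5, h6, mul_zero, pow_zero, one_mul, mul_comm _ ν, pow_mul]

lemma GG_rescale {s : ℂ} (hs : s ^ 13 = 1) (v : Fin 6 → ℂ) : GG0 (rescale s v) = GG0 v ∧
    GG1 (rescale s v) = s * GG1 v ∧ GG2 (rescale s v) = s ^ 2 * GG2 v ∧
    GG3 (rescale s v) = s ^ 3 * GG3 v ∧ GG4 (rescale s v) = s ^ 4 * GG4 v ∧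
    GG5 (rescale s v) = s ^ 5 * GG5 v ∧ GG6 (rescale s v) = s ^ 6 * GG6 v ∧
    GG7 (rescale s v) = s ^ 7 * GG7 v ∧ GG8 (rescale s v) = s ^ 8 * GG8 v ∧
    GG9 (rescale s v) = s ^ 9 * GG9 v ∧ GG10 (rescale s v) = s ^ 10 * GG10 v ∧
    GG11 (rescale s v) = s ^ 11 * GG11 v ∧ GG12 (rescale s v) = s ^ 12 * GG12 v := by
  obtain ⟨h0, h1, h2, h3, h4, h5, h6, h7, h8, h9, h10, h11, h12, hi⟩ := DD_rescale hs v
  simp only [GG0, GG1, GG2, GG3, GG4, GG5, GG6, GG7, GG8, GG9, GG10, GG11, GG12,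
    h0, h1, h2, h3, h4, h5, h6, h7, h8, h9, h10, h11, h12, hi, true_and]
  refine ⟨?_, ?_, ?_, ?_, ?_, ?_, ?_, ?_, ?_, ?_, ?_, ?_⟩ <;> grind

lemma dF_zero_rescale (ν : ℕ) (v : Fin 6 → ℂ) : dF 0 (rescale (ζ ^ ν) v) = dF ν v := by
  obtain ⟨h0, h1, h2, h3, h4, h5, h6, h7, h8, h9, h10, h11, h12⟩ :=
    GG_rescale (zeta_pow_pow_thirteen ν) v
  simp only [dF, mul_zero, pow_zero, one_mul, mul_comm _ ν, pow_mul, h0, h1, h2, h3, h4, h5, h6,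
    h7, h8, h9, h10, h11, h12]

lemma dInf_wInf_toVec_comp_mul (v : Fin 6 → ℂ) {u : ZMod 13} (hu : u ≠ 0) :
    dInf (toVec fun x ↦ oddExt v (u * x)) = dInf v ∧
      wInf (toVec fun x ↦ oddExt v (u * x)) = wInf v := by
  obtain ⟨h0, h1, h2, h3, h4, h5, h6, h7, h8, h9, h10, h11, h12⟩ := oddExt_values v
  simp only [toVec, dInf, wInf, GG0, DD0, DDinf, AA0, Matrix.cons_val]
  generalize oddExt v = w at *
  have : u = 1 ∨ u = 2 ∨ u = 3 ∨ u = 4 ∨ u = 5 ∨ u = 6 ∨ u = 7 ∨ u = 8 ∨ u = 9 ∨ u = 10 ∨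
    u = 11 ∨ u = 12 := by revert u; decide
  rcases this with h | h | h | h | h | h | h | h | h | h | h | h <;> subst h <;>
  · reduce_mod_char
    simp only [h1, h2, h3, h4, h5, h6, h7, h8, h9, h10, h11, h12]
    constructor <;> ring

lemma sum_range_thirteen (f : ZMod 13 → ℂ) :
    ∑ ν ∈ Finset.range 13, f (ν : ZMod 13) = ∑ μ, f μ := by
  rw [Finset.sum_range, sum_zmod13]
  simp [Fin.sum_univ_castSucc]

lemma twist13_neg (μ : ZMod 13) {φ : ZMod 13 → ℂ} (hφ : ∀ a, φ (-a) = -φ a) (a : ZMod 13) :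
    twist13 μ φ (-a) = -twist13 μ φ a := by
  simp only [twist13, neg_sq, hφ, mul_neg]

/-- If `P` is invariant under translation and dilation of odd functions on `ZMod 13`, and its
composition with the Fourier transform is a multiple of `Q`, then the power sums of the orbit
consisting of `P` and of the translates of `Q` are invariant under the Fourier transform. -/
lemma powerSum_fourier13 (P Q : (Fin 6 → ℂ) → ℂ) (e k : ℕ)
    (hF : ∀ v, P (toVec (fourier13 (oddExt v))) = 13 ^ e * Q v)
    (hT : ∀ μ v, P (toVec (twist13 μ (oddExt v))) = P v)
    (hR : ∀ u v, u ≠ 0 → P (toVec fun x ↦ oddExt v (u * x)) = P v)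
    (hP : ∀ (c : ℂ) v, P (c • v) = (c ^ 2) ^ e * P v) (v : Fin 6 → ℂ) :
    ∑ μ, Q (toVec (twist13 μ (fourier13 (oddExt v)))) ^ k + P (toVec (fourier13 (oddExt v))) ^ k =
      (13 ^ e) ^ k * (∑ μ, Q (toVec (twist13 μ (oddExt v))) ^ k + P v ^ k) := by
  have : Fact (Nat.Prime 13) := ⟨by norm_num⟩
  have h13 : (13 : ℂ) ^ e ≠ 0 := pow_ne_zero _ (by norm_num)
  have odd_fourier (w : Fin 6 → ℂ) : oddExt (toVec (fourier13 (oddExt w))) = fourier13 (oddExt w) :=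
    oddExt_toVec (fourier13_neg (oddExt_neg w))
  have smul_toVec (c : ℂ) (φ : ZMod 13 → ℂ) : toVec (fun a ↦ c * φ a) = c • toVec φ := by
    ext i; fin_cases i <;> simp [toVec]
  have twist_zero (φ : ZMod 13 → ℂ) : twist13 0 φ = φ := by
    ext a; simp [twist13]
  have key0 : Q (toVec (fourier13 (oddExt v))) = 13 ^ e * P v := by
    have h := hF (toVec (fourier13 (oddExt v)))
    have h2 : fourier13 (fourier13 (oddExt v)) = fun a ↦ -13 * oddExt v a := by
      ext a; rw [fourier13_fourier13, oddExt_neg]; ring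
    rw [odd_fourier, h2, smul_toVec, toVec_oddExt, hP] at h
    refine mul_left_cancel₀ h13 (h.symm.trans ?_)
    rw [← mul_assoc, ← mul_pow]
    norm_num
  have key (μ : ZMod 13) (hμ : μ ≠ 0) : Q (toVec (twist13 μ (fourier13 (oddExt v)))) =
      13 ^ e * Q (toVec (twist13 (-μ⁻¹) (oddExt v))) := by
    have h := hF (toVec (twist13 μ (fourier13 (oddExt v))))
    rw [oddExt_toVec (twist13_neg μ (fourier13_neg (oddExt_neg v)))] at h
    have h2 := funext (fourier13_twist13_fourier13 (mul_inv_cancel₀ hμ) (oddExt v))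
    set w := toVec (twist13 (-μ⁻¹) (oddExt v)) with hw
    have h3 : twist13 (-μ⁻¹) (oddExt v) = oddExt w :=
      (oddExt_toVec (twist13_neg _ (oddExt_neg v))).symm
    have h4 : (fun x ↦ fourier13 (oddExt w) (-μ⁻¹ * x)) =
        oddExt (toVec fun x ↦ fourier13 (oddExt w) (-μ⁻¹ * x)) := by
      refine (oddExt_toVec fun a ↦ ?_).symm
      rw [mul_neg, fourier13_neg (oddExt_neg w)]
    have h5 := hR (-μ⁻¹) (toVec (fourier13 (oddExt w))) (neg_ne_zero.mpr (inv_ne_zero hμ))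
    rw [odd_fourier] at h5
    rw [h2, smul_toVec, hP, gauss13_sq hμ, h3, h4, hT, h5, hF] at h
    exact (mul_left_cancel₀ h13 h).symm
  rw [← Finset.add_sum_erase _ _ (Finset.mem_univ (0 : ZMod 13)),
    ← Finset.add_sum_erase (a := (0 : ZMod 13)) _ (fun μ ↦ Q (toVec (twist13 μ (oddExt v))) ^ k)
      (Finset.mem_univ _), twist_zero, twist_zero, key0, hF, toVec_oddExt]
  have : ∑ μ ∈ Finset.univ.erase 0, Q (toVec (twist13 μ (fourier13 (oddExt v)))) ^ k =
      (13 ^ e) ^ k * ∑ μ ∈ Finset.univ.erase 0, Q (toVec (twist13 μ (oddExt v))) ^ k := by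
    rw [Finset.mul_sum]
    refine Finset.sum_bij' (fun μ _ ↦ -μ⁻¹) (fun μ _ ↦ -μ⁻¹) ?_ ?_ ?_ ?_ ?_
    · simp
    · simp
    · simp [inv_neg]
    · simp [inv_neg]
    · intro μ hμ
      rw [key μ (by simpa using hμ), mul_pow]
  rw [this]
  ring

lemma dInf_smul (c : ℂ) (v : Fin 6 → ℂ) : dInf (c • v) = (c ^ 2) ^ 3 * dInf v := by
  simp only [dInf, GG0, DD0, DDinf, Pi.smul_apply, smul_eq_mul]; ring

lemma wInf_smul (c : ℂ) (v : Fin 6 → ℂ) : wInf (c • v) = (c ^ 2) ^ 2 * wInf v := by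
  simp only [wInf, AA0, Pi.smul_apply, smul_eq_mul]; ring

lemma dF_zero_toVec_twist13 (ν : ℕ) {φ : ZMod 13 → ℂ} (hφ : ∀ a, φ (-a) = -φ a) :
    dF 0 (toVec (twist13 ν φ)) = dF ν (toVec φ) := by
  rw [← dF_zero_rescale ν (toVec φ), ← toVec_twist13_oddExt, oddExt_toVec hφ]

lemma wF_zero_toVec_twist13 (ν : ℕ) {φ : ZMod 13 → ℂ} (hφ : ∀ a, φ (-a) = -φ a) :
    wF 0 (toVec (twist13 ν φ)) = wF ν (toVec φ) := by
  rw [← wF_zero_rescale ν (toVec φ), ← toVec_twist13_oddExt, oddExt_toVec hφ]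

/-- The `k`-th power sum of the fourteen sextic forms `δ_∞, δ₀, …, δ₁₂`. -/
def dSum (k : ℕ) (v : Fin 6 → ℂ) : ℂ := (∑ ν ∈ Finset.range 13, dF ν v ^ k) + dInf v ^ k

/-- The `k`-th power sum of the fourteen quartic forms `w_∞, w₀, …, w₁₂`. -/
def wSum (k : ℕ) (v : Fin 6 → ℂ) : ℂ := (∑ ν ∈ Finset.range 13, wF ν v ^ k) + wInf v ^ k

lemma dSum_toVec (k : ℕ) {φ : ZMod 13 → ℂ} (hφ : ∀ a, φ (-a) = -φ a) :
    dSum k (toVec φ) = ∑ μ, dF 0 (toVec (twist13 μ φ)) ^ k + dInf (toVec φ) ^ k := by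
  simp only [dSum, ← dF_zero_toVec_twist13 _ hφ]
  rw [sum_range_thirteen fun μ ↦ dF 0 (toVec (twist13 μ φ)) ^ k]

lemma wSum_toVec (k : ℕ) {φ : ZMod 13 → ℂ} (hφ : ∀ a, φ (-a) = -φ a) :
    wSum k (toVec φ) = ∑ μ, wF 0 (toVec (twist13 μ φ)) ^ k + wInf (toVec φ) ^ k := by
  simp only [wSum, ← wF_zero_toVec_twist13 _ hφ]
  rw [sum_range_thirteen fun μ ↦ wF 0 (toVec (twist13 μ φ)) ^ k]

lemma twist13_twist13 (μ ν : ZMod 13) (φ : ZMod 13 → ℂ) :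
    twist13 μ (twist13 ν φ) = twist13 (μ + ν) φ := by
  ext a
  simp only [twist13]
  rw [← mul_assoc, ← AddChar.map_add_eq_mul]
  ring_nf

lemma dInf_toVec_twist13 (μ : ZMod 13) (v : Fin 6 → ℂ) :
    dInf (toVec (twist13 μ (oddExt v))) = dInf v := by
  rw [← ZMod.natCast_zmod_val μ, toVec_twist13_oddExt, dInf_rescale (zeta_pow_pow_thirteen _)]

lemma wInf_toVec_twist13 (μ : ZMod 13) (v : Fin 6 → ℂ) :
    wInf (toVec (twist13 μ (oddExt v))) = wInf v := by
  rw [← ZMod.natCast_zmod_val μ, toVec_twist13_oddExt, wInf_rescale (zeta_pow_pow_thirteen _)]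

lemma dSum_toVec_twist13 (k : ℕ) (ν : ZMod 13) (v : Fin 6 → ℂ) :
    dSum k (toVec (twist13 ν (oddExt v))) = dSum k v := by
  rw [dSum_toVec _ (twist13_neg ν (oddExt_neg v)), dInf_toVec_twist13]
  simp only [twist13_twist13]
  have h := Equiv.sum_comp (Equiv.addRight ν) fun μ ↦ dF 0 (toVec (twist13 μ (oddExt v))) ^ k
  simp only [Equiv.coe_addRight] at h
  rw [h]
  conv_rhs => rw [← toVec_oddExt v, dSum_toVec _ (oddExt_neg v), toVec_oddExt]

lemma wSum_toVec_twist13 (k : ℕ) (ν : ZMod 13) (v : Fin 6 → ℂ) :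
    wSum k (toVec (twist13 ν (oddExt v))) = wSum k v := by
  rw [wSum_toVec _ (twist13_neg ν (oddExt_neg v)), wInf_toVec_twist13]
  simp only [twist13_twist13]
  have h := Equiv.sum_comp (Equiv.addRight ν) fun μ ↦ wF 0 (toVec (twist13 μ (oddExt v))) ^ k
  simp only [Equiv.coe_addRight] at h
  rw [h]
  conv_rhs => rw [← toVec_oddExt v, wSum_toVec _ (oddExt_neg v), toVec_oddExt]

lemma dSum_fourier13 (k : ℕ) (v : Fin 6 → ℂ) :
    dSum k (toVec (fourier13 (oddExt v))) = (13 ^ 3) ^ k * dSum k v := by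
  rw [dSum_toVec _ (fourier13_neg (oddExt_neg v)), powerSum_fourier13 dInf (dF 0) 3 k
    dInf_toVec_fourier13 dInf_toVec_twist13 (fun u v hu ↦ (dInf_wInf_toVec_comp_mul v hu).1)
    dInf_smul]
  nth_rewrite 3 [← toVec_oddExt v]
  rw [dSum_toVec _ (oddExt_neg v), toVec_oddExt]

lemma wSum_fourier13 (k : ℕ) (v : Fin 6 → ℂ) :
    wSum k (toVec (fourier13 (oddExt v))) = (13 ^ 2) ^ k * wSum k v := by
  rw [wSum_toVec _ (fourier13_neg (oddExt_neg v)), powerSum_fourier13 wInf (wF 0) 2 k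
    wInf_toVec_fourier13 wInf_toVec_twist13 (fun u v hu ↦ (dInf_wInf_toVec_comp_mul v hu).2)
    wInf_smul]
  nth_rewrite 3 [← toVec_oddExt v]
  rw [wSum_toVec _ (oddExt_neg v), toVec_oddExt]

lemma dF_smul (ν : ℕ) (c : ℂ) (v : Fin 6 → ℂ) : dF ν (c • v) = (c ^ 2) ^ 3 * dF ν v := by
  simp only [dF, GG0, GG1, GG2, GG3, GG4, GG5, GG6, GG7, GG8, GG9, GG10, GG11, GG12, DD0, DD1, DD2,
    DD3, DD4, DD5, DD6, DD7, DD8, DD9, DD10, DD11, DD12, DDinf, Pi.smul_apply, smul_eq_mul]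
  ring

lemma wF_smul (ν : ℕ) (c : ℂ) (v : Fin 6 → ℂ) : wF ν (c • v) = (c ^ 2) ^ 2 * wF ν v := by
  simp only [wF, AA0, AA1, AA2, AA3, AA4, AA5, AA6, Pi.smul_apply, smul_eq_mul]
  ring

lemma dSum_smul (k : ℕ) (c : ℂ) (v : Fin 6 → ℂ) :
    dSum k (c • v) = ((c ^ 2) ^ 3) ^ k * dSum k v := by
  simp only [dSum, dF_smul, dInf_smul, mul_pow, ← Finset.mul_sum, mul_add]

lemma wSum_smul (k : ℕ) (c : ℂ) (v : Fin 6 → ℂ) :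
    wSum k (c • v) = ((c ^ 2) ^ 2) ^ k * wSum k v := by
  simp only [wSum, wF_smul, wInf_smul, mul_pow, ← Finset.mul_sum, mul_add]

/-- The term of index `m` in the theta series of order 13. -/
def thetaTerm (z : ℂ) (m : ℤ) : ℂ := (-1) ^ m * exp (2 * Real.pi * I * z * (2 * m + 13) ^ 2 / 104)

/-- The theta series of order 13 summed over a residue class modulo 13. -/
def psi13 (z : ℂ) (b : ℤ) : ℂ := ∑' n : ℤ, thetaTerm z (b + 13 * n)

/-- The theta series of order 13, as a function on `ZMod 13`. -/
def phi13 (z : ℂ) (a : ZMod 13) : ℂ := psi13 z a.val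

lemma psi13_add_thirteen_mul (z : ℂ) (b k : ℤ) : psi13 z (b + 13 * k) = psi13 z b := by
  rw [psi13, psi13, ← (Equiv.addRight k).tsum_eq fun n ↦ thetaTerm z (b + 13 * n)]
  refine tsum_congr fun n ↦ ?_
  congr 1
  simp only [Equiv.coe_addRight]; ring

lemma psi13_neg (z : ℂ) (b : ℤ) : psi13 z (-b) = -psi13 z b := by
  rw [psi13, psi13, ← tsum_neg, ← (Equiv.subLeft (-1 : ℤ)).tsum_eq]
  refine tsum_congr fun n ↦ ?_
  have h : -b + 13 * (-1 - n) = -(b + 13 * n) - 13 := by ring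
  simp only [Equiv.subLeft_apply, h, thetaTerm]
  rw [zpow_sub₀ (by norm_num), zpow_neg, ← inv_zpow, inv_neg_one]
  push_cast
  rw [show (-1 : ℂ) ^ (13 : ℤ) = -1 by norm_num [zpow_ofNat]]
  rw [show (2 * (-((b : ℂ) + 13 * n) - 13) + 13) ^ 2 = (2 * (b + 13 * n) + 13) ^ 2 by ring]
  ring

lemma phi13_intCast (z : ℂ) (b : ℤ) : phi13 z b = psi13 z b := by
  have h : ((b : ZMod 13).val : ℤ) = b % 13 := ZMod.val_intCast b
  rw [phi13, h]
  conv_rhs => rw [← Int.emod_add_mul_ediv b 13]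
  rw [psi13_add_thirteen_mul]

lemma phi13_neg (z : ℂ) (a : ZMod 13) : phi13 z (-a) = -phi13 z a := by
  obtain ⟨b, rfl⟩ := ZMod.intCast_surjective a
  rw [← Int.cast_neg, phi13_intCast, phi13_intCast, psi13_neg]

lemma psi13_eq_th13 (z : ℂ) (b : ℤ) :
    psi13 z b = (-1) ^ b * th13 ((2 * b + 13) ^ 2 / 104) (2 * b + 13) z := by
  rw [psi13, th13, ← mul_assoc, ← tsum_mul_left]
  refine tsum_congr fun n ↦ ?_
  have h : (-1 : ℂ) ^ (13 * n) = (-1) ^ n := by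
    rw [zpow_mul]; norm_num [zpow_ofNat]
  have h' : exp (2 * Real.pi * I * z * (2 * ↑(b + 13 * n) + 13) ^ 2 / 104) =
      exp (2 * Real.pi * I * (((2 * b + 13) ^ 2 / 104 : ℚ) : ℂ) * z) *
        exp (2 * Real.pi * I * (((13 * n ^ 2 + (2 * b + 13) * n : ℤ) : ℂ) / 2) * z) := by
    rw [← exp_add]; congr 1; push_cast; ring
  rw [thetaTerm, zpow_add₀ (by norm_num), h, h']
  ring

lemma AV_eq_toVec (z : ℂ) : AV z = toVec (phi13 z) := by
  have h (b : ℤ) : phi13 z (-b) = (-1) ^ (-b) * th13 ((2 * (-b : ℤ) + 13) ^ 2 / 104)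
      (2 * (-b) + 13) z := by
    rw [← Int.cast_neg, phi13_intCast, psi13_eq_th13]
  have h' (b : ℤ) : phi13 z b = -((-1) ^ (-b) * th13 ((2 * (-b : ℤ) + 13) ^ 2 / 104)
      (2 * (-b) + 13) z) := by rw [← h, phi13_neg, neg_neg]
  have h1 := h' 1
  have h2 := h' 2
  have h3 := h' 3
  have h4 := h' 4
  have h5 := h' 5
  have h6 := h' 6
  norm_num [zpow_neg, zpow_ofNat] at h1 h2 h3 h4 h5 h6
  ext i
  fin_cases i <;> simp [AV, ta, toVec, h1, h2, h3, h4, h5, h6]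

lemma exp_int_mul_pi_mul_I (n : ℤ) : exp (n * (Real.pi * I)) = (-1) ^ n := by
  rw [exp_int_mul, exp_pi_mul_I]

lemma psi13_eq_jacobiTheta₂ (z : ℂ) (b : ℤ) :
    psi13 z b = (-1) ^ b * exp (2 * Real.pi * I * z * (2 * b + 13) ^ 2 / 104) *
      jacobiTheta₂ (-13 / 2 + (2 * b + 13) * z / 2) (13 * z) := by
  rw [psi13, jacobiTheta₂, ← tsum_mul_left]
  refine tsum_congr fun n ↦ ?_
  have h : (-1 : ℂ) ^ (13 * n) = exp ((-13 * n : ℤ) * (Real.pi * I)) := by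
    rw [exp_int_mul_pi_mul_I, zpow_mul, zpow_mul]; norm_num [zpow_ofNat]
  rw [thetaTerm, jacobiTheta₂_term, zpow_add₀ (by norm_num), h, mul_assoc, ← exp_add,
    mul_assoc ((-1) ^ b), ← exp_add]
  congr 2
  push_cast
  ring

lemma fourier13_phi13 {z : ℂ} (hz : 0 < z.im) (b : ℤ) :
    fourier13 (phi13 z) b =
      exp (2 * Real.pi * I * (13 * z / 8)) * jacobiTheta₂ (1 / 2 + b / 13 + z / 2) (z / 13) := by
  set w := 1 / 2 + (b : ℂ) / 13 + z / 2 with hw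
  have hs : Summable fun m : ℤ ↦ jacobiTheta₂_term m w (z / 13) :=
    (summable_jacobiTheta₂_term_iff _ _).mpr (by simpa [Complex.div_ofNat_im] using hz)
  let e : Fin 13 × ℤ ≃ ℤ := (Equiv.prodComm (Fin 13) ℤ).trans (Int.divModEquiv 13).symm
  have he := Summable.tsum_prod (e.summable_iff.mpr hs)
  rw [jacobiTheta₂, ← e.tsum_eq, show ∑' c, jacobiTheta₂_term (e c) w (z / 13) = _ from he,
    tsum_fintype, Finset.mul_sum]
  refine Finset.sum_congr rfl fun (a : ZMod 13) _ ↦ ?_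
  have hab : e13 (a * b) = exp (2 * Real.pi * I * (a.val * b) / 13) := by
    have := ZMod.stdAddChar_coe (N := 13) (a.val * b)
    push_cast at this
    rwa [ZMod.natCast_zmod_val] at this
  rw [phi13, psi13, hab, ← tsum_mul_left, ← tsum_mul_left]
  refine tsum_congr fun n ↦ ?_
  have hn : e (a, n) = a.val + 13 * n := by
    simp only [e, Equiv.trans_apply, Equiv.prodComm_apply, Prod.swap, Int.divModEquiv_symm_apply]
    push_cast
    exact (add_comm _ _).trans (by rw [mul_comm]; rfl)
  rw [Function.comp_apply, hn]
  generalize hm : (a.val : ℤ) + 13 * n = m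
  have hb : exp (2 * Real.pi * I * (a.val * b) / 13) = exp (2 * Real.pi * I * (m * b) / 13) := by
    rw [exp_eq_exp_iff_exists_int]
    refine ⟨-(n * b), ?_⟩
    rw [← hm]
    push_cast
    ring
  rw [hb, thetaTerm, jacobiTheta₂_term, ← exp_int_mul_pi_mul_I, ← exp_add, ← exp_add, ← exp_add, hw]
  congr 1
  ring

lemma phi13_neg_inv {z : ℂ} (hz : 0 < z.im) :
    phi13 (-1 / z) = fun a ↦ I * (-I * z / 13) ^ (1 / 2 : ℂ) * fourier13 (phi13 z) a := by
  have hz0 : z ≠ 0 := by rintro rfl; simp at hz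
  ext a
  obtain ⟨b, rfl⟩ := ZMod.intCast_surjective a
  have hK : (-I * z / 13) ^ (1 / 2 : ℂ) ≠ 0 := by
    rw [Ne, cpow_eq_zero_iff]
    simp [hz0]
  have h1 : (-1 : ℂ) ^ b * exp (2 * Real.pi * I * (-1 / z) * (2 * b + 13) ^ 2 / 104) =
      I * exp (2 * Real.pi * I * (13 * z / 8)) *
        exp (-Real.pi * I * (1 / 2 + b / 13 + z / 2) ^ 2 / (z / 13)) := by
    have hI : I = exp (Real.pi / 2 * I) := exp_pi_div_two_mul_I.symm
    have h2 : exp (13 * (Real.pi / 2 * I)) = I := by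
      rw [show (13 : ℂ) * (Real.pi / 2 * I) = (13 : ℕ) * (Real.pi / 2 * I) by norm_num, exp_nat_mul,
        ← hI, show 13 = 4 * 3 + 1 by rfl, pow_succ, pow_mul, I_pow_four, one_pow, one_mul]
    have h3 : exp ((-b : ℤ) * (Real.pi * I)) = (-1) ^ b := by
      rw [exp_int_mul_pi_mul_I, zpow_neg, ← inv_zpow, inv_neg_one]
    rw [← h3]
    nth_rewrite 3 [← h2]
    rw [← exp_add, ← exp_add, ← exp_add]
    congr 1
    push_cast
    field_simp
    ring
  have h4 : -13 / 2 + (2 * (b : ℂ) + 13) * (-1 / z) / 2 =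
      -((1 / 2 + b / 13 + z / 2) / (z / 13)) := by
    field_simp
    ring
  rw [phi13_intCast, psi13_eq_jacobiTheta₂, fourier13_phi13 hz,
    jacobiTheta₂_functional_equation (1 / 2 + b / 13 + z / 2), h1, h4, jacobiTheta₂_neg_left,
    show 13 * (-1 / z) = -1 / (z / 13) by field_simp,
    show -I * (z / 13) = -I * z / 13 by ring]
  field_simp

lemma phi13_add_one (z : ℂ) :
    phi13 (z + 1) = fun a ↦ exp (13 * Real.pi * I / 4) * twist13 1 (phi13 z) a := by
  ext a
  obtain ⟨b, rfl⟩ := ZMod.intCast_surjective a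
  have hb : e13 (7 * 1 * (b : ZMod 13) ^ 2) = exp (2 * Real.pi * I * (7 * b ^ 2) / 13) := by
    have := ZMod.stdAddChar_coe (N := 13) (7 * b ^ 2)
    push_cast at this
    rw [mul_one]
    exact this
  rw [twist13, phi13_intCast, phi13_intCast, hb, psi13, psi13, ← mul_assoc, ← tsum_mul_left]
  refine tsum_congr fun n ↦ ?_
  generalize hm : b + 13 * n = m
  have h : exp (2 * Real.pi * I * (7 * b ^ 2) / 13) =
      exp (2 * Real.pi * I * (m ^ 2 + 13 * m) / 26) := by
    rw [exp_eq_exp_iff_exists_int]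
    have hb : b = m - 13 * n := by omega
    have hev : Even (m ^ 2 - m) := by
      rw [sq, ← mul_sub_one]; exact Int.even_mul_pred_self m
    obtain ⟨c, hc⟩ := hev
    refine ⟨c - 14 * m * n + 91 * n ^ 2, ?_⟩
    have hc' : (c : ℂ) = (m ^ 2 - m) / 2 := by
      rw [eq_div_iff two_ne_zero]; exact_mod_cast by linarith
    rw [hb]
    push_cast
    rw [hc']
    ring
  rw [h, thetaTerm, thetaTerm, mul_left_comm, ← exp_add, ← exp_add]
  congr 2
  ring

lemma AV_neg_inv {z : ℂ} (hz : 0 < z.im) : AV (-1 / z) =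
    (I * (-I * z / 13) ^ (1 / 2 : ℂ)) • toVec (fourier13 (oddExt (AV z))) := by
  rw [AV_eq_toVec, AV_eq_toVec, oddExt_toVec (phi13_neg z), phi13_neg_inv hz]
  ext i; fin_cases i <;> simp [toVec]

lemma AV_add_one (z : ℂ) :
    AV (z + 1) = exp (13 * Real.pi * I / 4) • toVec (twist13 1 (oddExt (AV z))) := by
  rw [AV_eq_toVec, AV_eq_toVec, oddExt_toVec (phi13_neg z), phi13_add_one]
  ext i; fin_cases i <;> simp [toVec]

lemma dSum_AV_neg_inv (k : ℕ) {z : ℂ} (hz : 0 < z.im) :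
    dSum k (AV (-1 / z)) = ((I * z) ^ 3) ^ k * dSum k (AV z) := by
  have h : ((-I * z / 13) ^ (1 / 2 : ℂ)) ^ 2 = -I * z / 13 := by
    rw [← cpow_nat_mul]; norm_num
  rw [AV_neg_inv hz, dSum_smul, dSum_fourier13, mul_pow I, h, I_sq, ← mul_assoc, ← mul_pow,
    ← mul_pow]
  ring_nf

lemma wSum_AV_neg_inv (k : ℕ) {z : ℂ} (hz : 0 < z.im) :
    wSum k (AV (-1 / z)) = ((I * z) ^ 2) ^ k * wSum k (AV z) := by
  have h : ((-I * z / 13) ^ (1 / 2 : ℂ)) ^ 2 = -I * z / 13 := by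
    rw [← cpow_nat_mul]; norm_num
  rw [AV_neg_inv hz, wSum_smul, wSum_fourier13, mul_pow I, h, I_sq, ← mul_assoc, ← mul_pow,
    ← mul_pow]
  ring_nf

lemma exp_thirteen_pi_mul_I_div_four_sq : exp (13 * Real.pi * I / 4) ^ 2 = I := by
  rw [← exp_nat_mul, show ((2 : ℕ) : ℂ) * (13 * Real.pi * I / 4) =
    Real.pi / 2 * I + (3 : ℤ) * (2 * Real.pi * I) by push_cast; ring, exp_add,
    exp_int_mul_two_pi_mul_I, exp_pi_div_two_mul_I, mul_one]

lemma dSum_AV_add_one (k : ℕ) (z : ℂ) : dSum k (AV (z + 1)) = (I ^ 3) ^ k * dSum k (AV z) := by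
  rw [AV_add_one, dSum_smul, dSum_toVec_twist13, exp_thirteen_pi_mul_I_div_four_sq]

lemma wSum_AV_add_one (k : ℕ) (z : ℂ) : wSum k (AV (z + 1)) = (I ^ 2) ^ k * wSum k (AV z) := by
  rw [AV_add_one, wSum_smul, wSum_toVec_twist13, exp_thirteen_pi_mul_I_div_four_sq]

section LevelOne
open UpperHalfPlane hiding I
open ModularForm MatrixGroups Filter Topology SlashInvariantForm

lemma tendsto_E_atImInfty {k : ℕ} (hk : 3 ≤ k) (hk' : Even k) :
    Tendsto (E hk : ℍ → ℂ) atImInfty (𝓝 1) := by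
  have hanal := ModularFormClass.analyticAt_cuspFunction_zero (E hk) one_pos
    one_mem_strictPeriods_SL
  have h0 : cuspFunction 1 (E hk) 0 = 1 := by
    rw [← EisensteinSeries.E_qExpansion_coeff_zero hk hk']
    simp [qExpansion_coeff]
  rw [← h0]
  exact (hanal.continuousAt.tendsto.comp (qParam_tendsto_atImInfty one_pos)).congr
    (fun τ ↦ SlashInvariantFormClass.eq_cuspFunction (E hk) τ one_mem_strictPeriods_SL one_ne_zero)

/-- A holomorphic function which transforms under `z ↦ z + 1` and `z ↦ -1 / z` like a level one
modular form `g` of weight less than 12, and has the same limit at infinity, is equal to `g`. -/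
lemma eq_of_levelOne {k : ℕ} (hk : k < 12) (g : ModularForm 𝒮ℒ k) {c : ℂ}
    (hg : Tendsto g atImInfty (𝓝 c)) {f : ℂ → ℂ} (hf : DifferentiableOn ℂ f upperHalfPlaneSet)
    (hT : ∀ z, 0 < z.im → f (z + 1) = f z) (hS : ∀ z, 0 < z.im → f (-1 / z) = z ^ k * f z)
    (hlim : Tendsto (fun z : ℍ ↦ f z) atImInfty (𝓝 c)) {z : ℂ} (hz : 0 < z.im) :
    f z = g ⟨z, hz⟩ := by
  let F : ℍ → ℂ := fun z ↦ f z
  have hFS : F ∣[(k : ℤ)] ModularGroup.S = F := by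
    ext z
    rw [SL_slash_apply, modular_S_smul]
    have := hS z z.im_pos
    have hz0 := ne_zero z
    rw [ModularGroup.denom_S]
    change f (-(z : ℂ))⁻¹ * (z : ℂ) ^ (-(k : ℤ)) = f z
    rw [show (-(z : ℂ))⁻¹ = -1 / z by field_simp, this, zpow_neg, zpow_natCast]
    field_simp
  have hFT : F ∣[(k : ℤ)] ModularGroup.T = F := by
    ext z
    have hd : denom ModularGroup.T z = 1 := by
      rw [ModularGroup.denom_apply]; simp [ModularGroup.T]
    rw [SL_slash_apply, modular_T_smul, hd]
    have := hT z z.im_pos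
    simpa [F, add_comm] using this
  have hgS (γ : SL(2, ℤ)) : (⇑g ∣[(k : ℤ)] γ) = ⇑g := g.slash_action_eq' _ ⟨γ, rfl⟩
  have hinv : ∀ γ : SL(2, ℤ), (F - g) ∣[(k : ℤ)] γ = F - g :=
    slash_action_generators_SL2Z
      (by rw [sub_eq_add_neg, SlashAction.add_slash, SlashAction.neg_slash, hgS, hFS])
      (by rw [sub_eq_add_neg, SlashAction.add_slash, SlashAction.neg_slash, hgS, hFT])
  have h0 : IsZeroAtImInfty (F - ⇑g) := by
    have := hlim.sub hg
    rwa [sub_self] at this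
  let C : CuspForm 𝒮ℒ k :=
    { toFun := F - ⇑g
      slash_action_eq' A hA := by
        obtain ⟨A, rfl⟩ := hA
        exact hinv A
      holo' := by
        refine MDifferentiable.sub ?_ g.holo'
        rw [UpperHalfPlane.mdifferentiable_iff]
        refine hf.congr fun z hz ↦ ?_
        simp [F, ofComplex_apply_of_im_pos hz]
      zero_at_cusps' hc := by
        rw [Subgroup.IsArithmetic.isCusp_iff_isCusp_SL2Z] at hc
        rw [OnePoint.isZeroAt_iff_forall_SL2Z hc]
        intro γ _
        rw [hinv]
        exact h0 }
  have hC : C = 0 := rank_zero_iff_forall_zero.mp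
    (CuspForm.rank_eq_zero_of_weight_lt_twelve (by exact_mod_cast hk)) C
  have := congrArg (fun C : CuspForm 𝒮ℒ k ↦ C ⟨z, hz⟩) hC
  exact sub_eq_zero.mp this

lemma etaF_eq_eta (z : ℂ) : etaF z = η z := by
  simp only [etaF, ModularForm.eta, Function.Periodic.qParam, eta_q_eq_pow]
  norm_num

lemma etaF_ne_zero {z : ℂ} (hz : 0 < z.im) : etaF z ≠ 0 := by
  rw [etaF_eq_eta]; exact eta_ne_zero hz

lemma differentiableOn_etaF : DifferentiableOn ℂ etaF upperHalfPlaneSet := by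
  rw [funext etaF_eq_eta]
  exact fun z hz ↦ (differentiableAt_eta_of_mem_upperHalfPlaneSet hz).differentiableWithinAt

lemma etaF_add_one (z : ℂ) : etaF (z + 1) = exp (Real.pi * I / 12) * etaF z := by
  have h : exp (2 * Real.pi * I * (z + 1)) = exp (2 * Real.pi * I * z) := by
    rw [mul_add, mul_one, exp_add, exp_two_pi_mul_I, mul_one]
  rw [etaF, etaF, h, ← mul_assoc, ← exp_add]
  ring_nf

lemma etaF_neg_inv_sq {z : ℂ} (hz : 0 < z.im) : etaF (-1 / z) ^ 2 = -I * z * etaF z ^ 2 := by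
  have h := eta_comp_eq_csqrt_I_inv hz
  have hs (w : ℂ) : sqrt w ^ 2 = w := by
    rw [sqrt, ← cpow_nat_mul]; norm_num
  simp only [Function.comp_apply, Pi.smul_apply, Pi.mul_apply, smul_eq_mul] at h
  rw [etaF_eq_eta, etaF_eq_eta, h, mul_pow, mul_pow, inv_pow, hs, hs, inv_I]
  ring

lemma discriminant_etaF {z : ℂ} (hz : 0 < z.im) :
    E₄ ⟨z, hz⟩ ^ 3 - E₆ ⟨z, hz⟩ ^ 2 = 1728 * etaF z ^ 24 := by
  have h := discriminant_eq_E₄_cube_sub_E₆_sq ⟨z, hz⟩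
  rw [discriminant, ← etaF_eq_eta] at h
  change etaF z ^ 24 = _ at h
  rw [h]; ring

lemma tendsto_tprod_one_sub_exp_pow :
    Tendsto (fun z : ℍ ↦ ∏' n : ℕ, (1 - exp (2 * Real.pi * I * z) ^ (n + 1))) atImInfty (𝓝 1) := by
  have hd :=
    (differentiableOn_tprod_one_sub_pow 0 (Metric.mem_ball_self one_pos)).continuousWithinAt
  have htprod := (hd.continuousAt (Metric.ball_mem_nhds 0 one_pos)).tendsto
  simpa [Function.comp_def, Function.Periodic.qParam] using
    htprod.comp (qParam_tendsto_atImInfty zero_lt_one)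

end LevelOne

section LeadingCoefficients

open Polynomial

/-- The polynomial `D` with `D (x) = dF 0 (0, x⁶, x³, -x, x¹⁰, 1)`. -/
def dPoly : ℂ[X] :=
  -1 + 2 * X + 2 * X ^ 2 - 2 * X ^ 3 - 8 * X ^ 4 + 6 * X ^ 5 + X ^ 6 - 8 * X ^ 7 + 17 * X ^ 8
  + 13 * X ^ 10 - 22 * X ^ 11 - 21 * X ^ 12 + 4 * X ^ 13 - 4 * X ^ 14 + 34 * X ^ 15 - 4 * X ^ 16
  - 24 * X ^ 17 - 6 * X ^ 18 + 32 * X ^ 19 + 24 * X ^ 20 + 6 * X ^ 21 - 13 * X ^ 22 - 10 * X ^ 23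
  - 26 * X ^ 24 - 8 * X ^ 26 - 30 * X ^ 27 - 12 * X ^ 28 - 12 * X ^ 29 + 28 * X ^ 30 + 26 * X ^ 31
  + 28 * X ^ 32 - 2 * X ^ 33 - 19 * X ^ 34 + 23 * X ^ 36 + 12 * X ^ 37 - 5 * X ^ 38 + 14 * X ^ 39
  - 2 * X ^ 40 + 16 * X ^ 41 + 10 * X ^ 42 - 16 * X ^ 43 - 14 * X ^ 44 - 2 * X ^ 45 - 2 * X ^ 46
  - 14 * X ^ 47 - 4 * X ^ 49 - 2 * X ^ 50 - 4 * X ^ 51 - 4 * X ^ 52 - 2 * X ^ 53 - 4 * X ^ 56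
  - X ^ 60

/-- The polynomial `W` with `W (x) ^ 2 = wF 0 (0, x⁶, x³, -x, x¹⁰, 1)`. -/
def wPoly : ℂ[X] :=
  -1 - X ^ 2 + X ^ 3 + 2 * X ^ 4 - X ^ 6 + 2 * X ^ 7 + X ^ 12 - 2 * X ^ 13 + X ^ 16 - X ^ 20

/-- The leading terms of the theta vector as a function of `r = exp (2 * π * i * z / 13)`. -/
def leadVec (r : ℂ) : Fin 6 → ℂ := ![0, r ^ 6, r ^ 3, -r, r ^ 10, 1]

lemma dF_zero_leadVec (x : ℂ) : dF 0 (leadVec x) = dPoly.eval x := by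
  simp only [dPoly, eval_add, eval_sub, eval_mul, eval_pow, eval_X, eval_ofNat, eval_neg, eval_one]
  simp only [dF, GG0, GG1, GG2, GG3, GG4, GG5, GG6, GG7, GG8, GG9, GG10, GG11, GG12, DD0, DD1, DD2,
    DD3, DD4, DD5, DD6, DD7, DD8, DD9, DD10, DD11, DD12, DDinf, leadVec, Matrix.cons_val]
  ring

lemma wF_zero_leadVec (x : ℂ) : wF 0 (leadVec x) = wPoly.eval x ^ 2 := by
  simp only [wPoly, eval_add, eval_sub, eval_mul, eval_pow, eval_X, eval_ofNat, eval_neg, eval_one]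
  simp only [wF, AA0, AA1, AA2, AA3, AA4, AA5, AA6, leadVec, Matrix.cons_val]
  ring

lemma rescale_leadVec {t : ℂ} (ht : t ^ 13 = 1) (r : ℂ) :
    rescale t (leadVec r) = t ^ 5 • leadVec (t * r) := by
  ext i
  fin_cases i <;> simp [rescale, leadVec] <;> grind

lemma dF_leadVec (ν : ℕ) (r : ℂ) : dF ν (leadVec r) = (ζ ^ ν) ^ 4 * dPoly.eval (ζ ^ ν * r) := by
  have ht := zeta_pow_pow_thirteen ν
  rw [← dF_zero_rescale, rescale_leadVec ht, dF_smul, dF_zero_leadVec]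
  linear_combination (((ζ ^ ν) ^ 13 + 1) * (ζ ^ ν) ^ 4 * dPoly.eval (ζ ^ ν * r)) * ht

lemma wF_leadVec (ν : ℕ) (r : ℂ) : wF ν (leadVec r) = (ζ ^ ν) ^ 7 * wPoly.eval (ζ ^ ν * r) ^ 2 := by
  have ht := zeta_pow_pow_thirteen ν
  rw [← wF_zero_rescale, rescale_leadVec ht, wF_smul, wF_zero_leadVec]
  linear_combination ((ζ ^ ν) ^ 7 * wPoly.eval (ζ ^ ν * r) ^ 2) * ht

lemma X_pow_dvd_mul_sub {N : ℕ} {p q s t u : ℂ[X]} (hp : X ^ N ∣ p - s) (hq : X ^ N ∣ q - t)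
    (hu : X ^ N ∣ s * t - u) : X ^ N ∣ p * q - u := by
  obtain ⟨a, ha⟩ := hp
  obtain ⟨b, hb⟩ := hq
  obtain ⟨c, hc⟩ := hu
  exact ⟨a * q + s * b + c, by linear_combination q * ha + s * hb + hc⟩

lemma coeff_eq_of_X_pow_dvd_sub {N i : ℕ} {p u : ℂ[X]} (h : X ^ N ∣ p - u) (hi : i < N) :
    p.coeff i = u.coeff i := by
  simpa [sub_eq_zero] using X_pow_dvd_iff.mp h i hi

lemma X_pow_dvd_dPoly_sub : (X : ℂ[X]) ^ 12 ∣ dPoly - (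
      -1 + 2 * X + 2 * X ^ 2 - 2 * X ^ 3 - 8 * X ^ 4 + 6 * X ^ 5 + X ^ 6 - 8 * X ^ 7 + 17 * X ^ 8
      + 13 * X ^ 10 - 22 * X ^ 11) :=
  ⟨
      -21 + 4 * X - 4 * X ^ 2 + 34 * X ^ 3 - 4 * X ^ 4 - 24 * X ^ 5 - 6 * X ^ 6 + 32 * X ^ 7
      + 24 * X ^ 8 + 6 * X ^ 9 - 13 * X ^ 10 - 10 * X ^ 11 - 26 * X ^ 12 - 8 * X ^ 14
      - 30 * X ^ 15 - 12 * X ^ 16 - 12 * X ^ 17 + 28 * X ^ 18 + 26 * X ^ 19 + 28 * X ^ 20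
      - 2 * X ^ 21 - 19 * X ^ 22 + 23 * X ^ 24 + 12 * X ^ 25 - 5 * X ^ 26 + 14 * X ^ 27
      - 2 * X ^ 28 + 16 * X ^ 29 + 10 * X ^ 30 - 16 * X ^ 31 - 14 * X ^ 32 - 2 * X ^ 33
      - 2 * X ^ 34 - 14 * X ^ 35 - 4 * X ^ 37 - 2 * X ^ 38 - 4 * X ^ 39 - 4 * X ^ 40 - 2 * X ^ 41
      - 4 * X ^ 44 - X ^ 48, by rw [dPoly]; ring⟩

lemma X_pow_dvd_dPoly_pow_2_sub : (X : ℂ[X]) ^ 12 ∣ dPoly ^ 2 - (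
      1 - 4 * X + 12 * X ^ 3 + 12 * X ^ 4 - 52 * X ^ 5 - 6 * X ^ 6 + 76 * X ^ 7 - 22 * X ^ 8
      - 64 * X ^ 9 + 94 * X ^ 10 + 168 * X ^ 11) := by
  rw [show dPoly ^ 2 = dPoly * dPoly by ring]
  exact X_pow_dvd_mul_sub X_pow_dvd_dPoly_sub X_pow_dvd_dPoly_sub ⟨
      -403 + 48 * X - 22 * X ^ 2 + 236 * X ^ 3 + 51 * X ^ 4 - 252 * X ^ 5 + 794 * X ^ 6
      - 748 * X ^ 7 + 169 * X ^ 8 - 572 * X ^ 9 + 484 * X ^ 10, by ring⟩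

lemma X_pow_dvd_dPoly_pow_3_sub : (X : ℂ[X]) ^ 12 ∣ dPoly ^ 3 - (
      -1 + 6 * X - 6 * X ^ 2 - 22 * X ^ 3 + 12 * X ^ 4 + 138 * X ^ 5 - 121 * X ^ 6 - 324 * X ^ 7
      + 291 * X ^ 8 + 616 * X ^ 9 - 753 * X ^ 10 - 726 * X ^ 11) := by
  rw [show dPoly ^ 3 = dPoly * dPoly ^ 2 by ring]
  exact X_pow_dvd_mul_sub X_pow_dvd_dPoly_sub X_pow_dvd_dPoly_pow_2_sub ⟨
      1986 - 76 * X - 2312 * X ^ 2 - 316 * X ^ 3 + 2306 * X ^ 4 - 552 * X ^ 5 - 1704 * X ^ 6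
      + 2508 * X ^ 7 + 2630 * X ^ 8 + 116 * X ^ 9 - 3696 * X ^ 10, by ring⟩

lemma X_pow_dvd_dPoly_pow_5_sub : (X : ℂ[X]) ^ 12 ∣ dPoly ^ 5 - (
      -1 + 10 * X - 30 * X ^ 2 - 10 * X ^ 3 + 160 * X ^ 4 + 142 * X ^ 5 - 1315 * X ^ 6
      + 240 * X ^ 7 + 5045 * X ^ 8 - 1360 * X ^ 9 - 17823 * X ^ 10 + 9530 * X ^ 11) := by
  rw [show dPoly ^ 5 = dPoly ^ 2 * dPoly ^ 3 by ring]
  exact X_pow_dvd_mul_sub X_pow_dvd_dPoly_pow_2_sub X_pow_dvd_dPoly_pow_3_sub ⟨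
      43438 - 30908 * X - 84888 * X ^ 2 + 78724 * X ^ 3 + 115230 * X ^ 4 - 135832 * X ^ 5
      - 105112 * X ^ 6 + 170956 * X ^ 7 + 79170 * X ^ 8 - 194748 * X ^ 9 - 121968 * X ^ 10, by ring⟩

lemma X_pow_dvd_dPoly_pow_7_sub : (X : ℂ[X]) ^ 12 ∣ dPoly ^ 7 - (
      -1 + 14 * X - 70 * X ^ 2 + 98 * X ^ 3 + 308 * X ^ 4 - 686 * X ^ 5 - 2877 * X ^ 6
      + 8724 * X ^ 7 + 9191 * X ^ 8 - 46312 * X ^ 9 - 34461 * X ^ 10 + 226842 * X ^ 11) := by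
  rw [show dPoly ^ 7 = dPoly ^ 2 * dPoly ^ 5 by ring]
  exact X_pow_dvd_mul_sub X_pow_dvd_dPoly_pow_2_sub X_pow_dvd_dPoly_pow_5_sub ⟨
      8282 - 613260 * X - 7624 * X ^ 2 + 1551844 * X ^ 3 - 718086 * X ^ 4 - 1903048 * X ^ 5
      + 1717976 * X ^ 6 + 1650732 * X ^ 7 - 2513762 * X ^ 8 - 2098444 * X ^ 9 + 1601040 * X ^ 10,
      by ring⟩

lemma X_pow_dvd_wPoly_sub : (X : ℂ[X]) ^ 15 ∣ wPoly - (
      -1 - X ^ 2 + X ^ 3 + 2 * X ^ 4 - X ^ 6 + 2 * X ^ 7 + X ^ 12 - 2 * X ^ 13) :=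
  ⟨
      X - X ^ 5, by rw [wPoly]; ring⟩

lemma X_pow_dvd_wPoly_pow_2_sub : (X : ℂ[X]) ^ 15 ∣ wPoly ^ 2 - (
      1 + 2 * X ^ 2 - 2 * X ^ 3 - 3 * X ^ 4 - 2 * X ^ 5 - X ^ 6 + 6 * X ^ 8 - 6 * X ^ 9
      + 8 * X ^ 11 - X ^ 12 + 2 * X ^ 14) := by
  rw [show wPoly ^ 2 = wPoly * wPoly by ring]
  exact X_pow_dvd_mul_sub X_pow_dvd_wPoly_sub X_pow_dvd_wPoly_sub ⟨
      6 - 8 * X ^ 2 - 2 * X ^ 3 + 8 * X ^ 4 - 8 * X ^ 5 + X ^ 9 - 4 * X ^ 10 + 4 * X ^ 11, by ring⟩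

lemma X_pow_dvd_wPoly_pow_4_sub : (X : ℂ[X]) ^ 15 ∣ wPoly ^ 4 - (
      1 + 4 * X ^ 2 - 4 * X ^ 3 - 2 * X ^ 4 - 12 * X ^ 5 - 10 * X ^ 6 + 4 * X ^ 7 + 25 * X ^ 8
      + 4 * X ^ 9 + 34 * X ^ 10 - 28 * X ^ 11 - 13 * X ^ 12 + 44 * X ^ 13 - 20 * X ^ 14) := by
  rw [show wPoly ^ 4 = wPoly ^ 2 * wPoly ^ 2 by ring]
  exact X_pow_dvd_mul_sub X_pow_dvd_wPoly_pow_2_sub X_pow_dvd_wPoly_pow_2_sub ⟨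
      -32 + 18 * X - 92 * X ^ 2 + 26 * X ^ 3 + 88 * X ^ 4 - 112 * X ^ 5 + 12 * X ^ 6 + 88 * X ^ 7
      - 40 * X ^ 8 + X ^ 9 + 32 * X ^ 10 - 4 * X ^ 11 + 4 * X ^ 13, by ring⟩

lemma X_pow_dvd_wPoly_pow_5_sub : (X : ℂ[X]) ^ 15 ∣ wPoly ^ 5 - (
      -1 - 5 * X ^ 2 + 5 * X ^ 3 + 20 * X ^ 5 + 15 * X ^ 6 - 35 * X ^ 8 - 30 * X ^ 9 - 81 * X ^ 10
      + 65 * X ^ 11 + 20 * X ^ 12 + 60 * X ^ 14) := by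
  rw [show wPoly ^ 5 = wPoly * wPoly ^ 4 by ring]
  exact X_pow_dvd_mul_sub X_pow_dvd_wPoly_sub X_pow_dvd_wPoly_pow_4_sub ⟨
      -79 + 18 * X + 156 * X ^ 2 - 69 * X ^ 3 - 46 * X ^ 4 + 125 * X ^ 5 - 86 * X ^ 6 + 26 * X ^ 7
      - 96 * X ^ 8 + 43 * X ^ 9 + 70 * X ^ 10 - 108 * X ^ 11 + 40 * X ^ 12, by ring⟩

lemma X_pow_dvd_wPoly_pow_10_sub : (X : ℂ[X]) ^ 15 ∣ wPoly ^ 10 - (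
      1 + 10 * X ^ 2 - 10 * X ^ 3 + 25 * X ^ 4 - 90 * X ^ 5 - 5 * X ^ 6 - 200 * X ^ 7
      + 120 * X ^ 8 + 210 * X ^ 9 + 912 * X ^ 10 + 420 * X ^ 11 + 695 * X ^ 12 - 2860 * X ^ 13
      - 1920 * X ^ 14) := by
  rw [show wPoly ^ 10 = wPoly ^ 5 * wPoly ^ 5 by ring]
  exact X_pow_dvd_mul_sub X_pow_dvd_wPoly_pow_5_sub X_pow_dvd_wPoly_pow_5_sub ⟨
      -3940 + 795 * X + 5450 * X ^ 2 + 7170 * X ^ 3 + 2710 * X ^ 4 + 3061 * X ^ 5 - 11730 * X ^ 6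
      - 3215 * X ^ 7 - 1000 * X ^ 8 - 9320 * X ^ 9 + 7800 * X ^ 10 + 2400 * X ^ 11 + 3600 * X ^ 13,
      by ring⟩

lemma X_pow_dvd_wPoly_pow_11_sub : (X : ℂ[X]) ^ 15 ∣ wPoly ^ 11 - (
      -1 - 11 * X ^ 2 + 11 * X ^ 3 - 33 * X ^ 4 + 110 * X ^ 5 - 11 * X ^ 6 + 297 * X ^ 7
      - 165 * X ^ 8 - 165 * X ^ 9 - 1287 * X ^ 10 - 770 * X ^ 11 - 1331 * X ^ 12 + 3960 * X ^ 13
      + 2959 * X ^ 14) := by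
  rw [show wPoly ^ 11 = wPoly * wPoly ^ 10 by ring]
  exact X_pow_dvd_mul_sub X_pow_dvd_wPoly_sub X_pow_dvd_wPoly_pow_10_sub ⟨
      4395 + 3 * X - 6376 * X ^ 2 - 3520 * X ^ 3 + 4060 * X ^ 4 - 3280 * X ^ 5 - 3870 * X ^ 6
      + 492 * X ^ 7 - 1404 * X ^ 8 - 145 * X ^ 9 - 4250 * X ^ 10 + 3800 * X ^ 11 + 3840 * X ^ 12,
      by ring⟩

lemma X_pow_dvd_wPoly_pow_22_sub : (X : ℂ[X]) ^ 15 ∣ wPoly ^ 22 - (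
      1 + 22 * X ^ 2 - 22 * X ^ 3 + 187 * X ^ 4 - 462 * X ^ 5 + 869 * X ^ 6 - 3740 * X ^ 7
      + 4081 * X ^ 8 - 13706 * X ^ 9 + 25564 * X ^ 10 - 20482 * X ^ 11 + 103697 * X ^ 12
      - 51238 * X ^ 13 + 146905 * X ^ 14) := by
  rw [show wPoly ^ 22 = wPoly ^ 11 * wPoly ^ 11 by ring]
  exact X_pow_dvd_mul_sub X_pow_dvd_wPoly_pow_11_sub X_pow_dvd_wPoly_pow_11_sub ⟨
      -443102 - 102003 * X - 1182170 * X ^ 2 + 699743 * X ^ 3 + 452056 * X ^ 4 + 4636841 * X ^ 5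
      + 2872056 * X ^ 6 + 1735624 * X ^ 7 - 9119770 * X ^ 8 - 11943305 * X ^ 9 - 15098380 * X ^ 10
      + 7804742 * X ^ 11 + 23435280 * X ^ 12 + 8755681 * X ^ 13, by ring⟩

lemma coeff_dPoly_pow_2_5 : (dPoly ^ 2).coeff 5 = -52 := by
  rw [coeff_eq_of_X_pow_dvd_sub X_pow_dvd_dPoly_pow_2_sub (by norm_num)]
  simp [coeff_one, coeff_X]

lemma coeff_dPoly_pow_3_1 : (dPoly ^ 3).coeff 1 = 6 := by
  rw [coeff_eq_of_X_pow_dvd_sub X_pow_dvd_dPoly_pow_3_sub (by norm_num)]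
  simp [coeff_one, coeff_X]

lemma coeff_dPoly_pow_5_6 : (dPoly ^ 5).coeff 6 = -1315 := by
  rw [coeff_eq_of_X_pow_dvd_sub X_pow_dvd_dPoly_pow_5_sub (by norm_num)]
  simp [coeff_one, coeff_X]

lemma coeff_dPoly_pow_7_11 : (dPoly ^ 7).coeff 11 = 226842 := by
  rw [coeff_eq_of_X_pow_dvd_sub X_pow_dvd_dPoly_pow_7_sub (by norm_num)]
  simp [coeff_one, coeff_X]

lemma coeff_wPoly_pow_22_1 : (wPoly ^ 22).coeff 1 = 0 := by
  rw [coeff_eq_of_X_pow_dvd_sub X_pow_dvd_wPoly_pow_22_sub (by norm_num)]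
  simp [coeff_one]

lemma coeff_wPoly_pow_22_14 : (wPoly ^ 22).coeff 14 = 146905 := by
  rw [coeff_eq_of_X_pow_dvd_sub X_pow_dvd_wPoly_pow_22_sub (by norm_num)]
  simp [coeff_one]

lemma sum_zeta_pow_pow (n : ℕ) :
    ∑ ν ∈ Finset.range 13, (ζ ^ ν) ^ n = if 13 ∣ n then 13 else 0 := by
  have hζ : IsPrimitiveRoot ζ 13 := by
    simpa [ζ] using Complex.isPrimitiveRoot_exp 13 (by norm_num)
  simp only [← pow_mul, mul_comm _ n]
  simp only [pow_mul]
  split_ifs with h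
  · simp [(hζ.pow_eq_one_iff_dvd n).mpr h]
  · have : n.Coprime 13 := ((Nat.Prime.coprime_iff_not_dvd (by norm_num)).mpr h).symm
    exact (hζ.pow_of_coprime n this).geom_sum_eq_zero (by norm_num)

/-- Averaging over the rescalings `x ↦ ζ ^ ν * x` keeps the coefficients in one residue class
modulo `13`; this isolates the first of them. -/
lemma exists_sum_zeta_pow_mul_eval (p : ℂ[X]) {a e : ℕ} (he : 13 ∣ a + e)
    (hlow : ∀ i < e, 13 ∣ a + i → p.coeff i = 0) :
    ∃ q : ℂ[X], ∀ x, ∑ ν ∈ Finset.range 13, (ζ ^ ν) ^ a * p.eval (ζ ^ ν * x) =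
      x ^ e * (13 * p.coeff e + x * q.eval x) := by
  set S : ℂ[X] := ∑ ν ∈ Finset.range 13, C ((ζ ^ ν) ^ a) * p.comp (C (ζ ^ ν) * X) with hS
  have hcoeff (i : ℕ) : S.coeff i = if 13 ∣ a + i then 13 * p.coeff i else 0 := by
    simp only [hS, finsetSum_coeff, coeff_C_mul, comp_C_mul_X_coeff]
    rw [← ite_zero_mul, ← sum_zeta_pow_pow, Finset.sum_mul]
    exact Finset.sum_congr rfl fun ν _ ↦ by ring
  obtain ⟨T, hT⟩ : X ^ e ∣ S := X_pow_dvd_iff.mpr fun i hi ↦ by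
    rw [hcoeff]
    split_ifs with h
    · rw [hlow i hi h, mul_zero]
    · rfl
  have hT0 : T.coeff 0 = 13 * p.coeff e := by
    have := hcoeff e
    rw [if_pos he, hT, coeff_X_pow_mul', if_pos le_rfl, Nat.sub_self] at this
    exact this
  refine ⟨T.divX, fun x ↦ ?_⟩
  calc _ = S.eval x := by simp [hS, eval_finsetSum]
    _ = x ^ e * (T.divX * X + C (T.coeff 0)).eval x := by rw [divX_mul_X_add, hT]; simp
    _ = _ := by simp only [eval_add, eval_mul, eval_X, eval_C, hT0]; ring

end LeadingCoefficients

section Asymptotics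

open UpperHalfPlane hiding I
open Filter Topology Asymptotics

lemma tendsto_div_pow_of_leadVec {α : Type*} {l : Filter α} {r : α → ℂ} (hr : Tendsto r l (𝓝 0))
    (hr0 : ∀ a, r a ≠ 0) {B : α → Fin 6 → ℂ} {N : ℕ}
    (hB : (fun a ↦ B a - leadVec (r a)) =O[l] fun a ↦ r a ^ N) {P : (Fin 6 → ℂ) → ℂ}
    (hP : ContDiff ℂ 1 P) {e : ℕ} (he : e < N) {F : ℂ → ℂ} (hF : ContinuousAt F 0)
    (hPF : ∀ x, P (leadVec x) = x ^ e * F x) :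
    Tendsto (fun a ↦ P (B a) / r a ^ e) l (𝓝 (F 0)) := by
  have hlead : Tendsto (fun a ↦ leadVec (r a)) l (𝓝 (leadVec 0)) := by
    have : Continuous leadVec := by unfold leadVec; fun_prop
    exact this.continuousAt.tendsto.comp hr
  have hrN : Tendsto (fun a ↦ r a ^ N) l (𝓝 0) := by
    simpa [zero_pow (Nat.ne_zero_of_lt he)] using hr.pow N
  have hBlim : Tendsto B l (𝓝 (leadVec 0)) := by
    simpa using (hB.trans_tendsto hrN).add hlead
  have hdiff : (fun a ↦ P (B a) - P (leadVec (r a))) =o[l] fun a ↦ r a ^ e := by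
    have h1 := (hP.contDiffAt (x := leadVec 0)).hasStrictFDerivAt one_ne_zero |>.isBigO_sub
    have h2 := h1.comp_tendsto (hBlim.prodMk_nhds hlead)
    refine (h2.trans hB).trans_isLittleO ?_
    exact (isLittleO_pow_pow he).comp_tendsto hr
  have h := hdiff.tendsto_div_nhds_zero.add (hF.tendsto.comp hr)
  rw [zero_add] at h
  refine h.congr fun a ↦ ?_
  rw [hPF, Function.comp_apply, sub_div, mul_div_cancel_left₀ _ (pow_ne_zero e (hr0 a))]
  ring

lemma summable_exp_one_sub_abs : Summable fun n : ℤ ↦ Real.exp (1 - |(n : ℝ)|) := by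
  have h : Summable fun n : ℕ ↦ Real.exp (1 - n) := by
    simpa [sub_eq_add_neg, Real.exp_add] using Real.summable_exp_neg_nat.mul_left (Real.exp 1)
  exact Summable.of_nat_of_neg (by simpa using h) (by simpa using h)

lemma isBigO_tsum_theta_sub_one {k : ℤ} {c : ℕ} (hc : 0 < c) (hk : |k| + 2 * c ≤ 13) :
    (fun z : ℍ ↦ (∑' n : ℤ, (-1 : ℂ) ^ n *
      exp (2 * Real.pi * I * (((13 * n ^ 2 + k * n : ℤ) : ℂ) / 2) * z)) - 1) =O[atImInfty]
      fun z : ℍ ↦ exp (2 * Real.pi * I * z) ^ c := by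
  set f : ℍ → ℤ → ℂ := fun z n ↦ (-1 : ℂ) ^ n *
    exp (2 * Real.pi * I * (((13 * n ^ 2 + k * n : ℤ) : ℂ) / 2) * z) with hf
  have hnorm (z : ℍ) (n : ℤ) : ‖f z n‖ = Real.exp (-(Real.pi * (13 * n ^ 2 + k * n) * z.im)) := by
    simp only [hf, norm_mul, norm_zpow, norm_neg, norm_one, one_zpow, one_mul, norm_exp]
    congr 1
    have : 2 * Real.pi * I * (((13 * n ^ 2 + k * n : ℤ) : ℂ) / 2) * z =
      ((Real.pi * (13 * n ^ 2 + k * n) : ℝ) : ℂ) * (I * z) := by push_cast; ring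
    rw [this, re_ofReal_mul]
    simp
  have hexp (n : ℤ) (hn : n ≠ 0) : 2 * c + 2 * (|(n : ℝ)| - 1) ≤ 13 * n ^ 2 + k * n := by
    have h1 : 1 ≤ |n| := Int.one_le_abs hn
    have h2 : -(|k| * |n|) ≤ k * n := by rw [← abs_mul]; exact neg_abs_le _
    have h3 : (2 * c + 2 * (|n| - 1) : ℤ) ≤ 13 * n ^ 2 + k * n := by
      rw [← sq_abs n]
      have hc' : (1 : ℤ) ≤ c := by exact_mod_cast hc
      nlinarith [mul_nonneg (sub_nonneg.mpr hc') (sub_nonneg.mpr h1),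
        mul_le_mul_of_nonneg_right hk (abs_nonneg n)]
    exact_mod_cast h3
  have hbound (z : ℍ) (hz : 1 ≤ z.im) (n : ℤ) (hn : n ≠ 0) :
      ‖f z n‖ ≤ ‖exp (2 * Real.pi * I * z) ^ c‖ * Real.exp (1 - |(n : ℝ)|) := by
    have h1 : ‖exp (2 * Real.pi * I * z) ^ c‖ = Real.exp (-(2 * Real.pi * c * z.im)) := by
      rw [← exp_nat_mul, norm_exp]
      congr 1
      have : (c : ℂ) * (2 * Real.pi * I * z) = ((2 * Real.pi * c : ℝ) : ℂ) * (I * z) := by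
        push_cast; ring
      rw [this, re_ofReal_mul]
      simp
    have h2 : (1 : ℝ) ≤ |(n : ℝ)| := by exact_mod_cast Int.one_le_abs hn
    have h3 : 1 ≤ Real.pi * z.im := by nlinarith [Real.pi_gt_three]
    rw [hnorm, h1, ← Real.exp_add, Real.exp_le_exp]
    have := mul_le_mul_of_nonneg_left (hexp n hn) (zero_le_one.trans h3)
    nlinarith [mul_nonneg (sub_nonneg.mpr h2) (sub_nonneg.mpr h3)]
  refine IsBigO.of_bound (∑' n : ℤ, Real.exp (1 - |(n : ℝ)|)) ?_
  filter_upwards [(atImInfty_mem _).mpr ⟨1, fun z hz ↦ hz⟩] with z (hz : 1 ≤ z.im)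
  set g : ℤ → ℝ := fun n ↦ ‖exp (2 * Real.pi * I * z) ^ c‖ * Real.exp (1 - |(n : ℝ)|)
  have hg : HasSum g _ := summable_exp_one_sub_abs.hasSum.mul_left _
  have hsum : Summable (f z) := by
    refine Summable.of_norm_bounded_eventually hg.summable ?_
    filter_upwards [(Set.finite_singleton (0 : ℤ)).compl_mem_cofinite] with n hn
    exact hbound z hz n hn
  have h0 : f z 0 = 1 := by simp [hf]
  change ‖(∑' n, f z n) - 1‖ ≤ _
  rw [hsum.tsum_eq_add_tsum_ite 0, h0, add_sub_cancel_left, mul_comm]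
  refine tsum_of_norm_bounded hg fun n ↦ ?_
  split_ifs with hn
  · rw [norm_zero]; positivity
  · exact hbound z hz n hn

/-- The local parameter of width `13` at the cusp. -/
def cuspParam (z : ℍ) : ℂ := exp (2 * Real.pi * I * z / 13)

lemma tendsto_cuspParam : Tendsto cuspParam atImInfty (𝓝 0) := by
  have := qParam_tendsto_atImInfty (h := 13) (by norm_num)
  simpa [Function.comp_def, Function.Periodic.qParam, cuspParam] using! this

lemma isBigO_AV :
    (fun z : ℍ ↦ (exp (2 * Real.pi * I * z / 104))⁻¹ • AV z - leadVec (cuspParam z))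
      =O[atImInfty] fun z ↦ cuspParam z ^ 15 := by
  have hle {m : ℕ} (hm : 15 ≤ m) :
      (fun z ↦ cuspParam z ^ m) =O[atImInfty] fun z ↦ cuspParam z ^ 15 :=
    IsBigO.comp_tendsto (f := fun x : ℂ ↦ x ^ m) (g := fun x : ℂ ↦ x ^ 15) (l := 𝓝 0)
    (IsBigO.of_bound'  <| by
      filter_upwards [Metric.closedBall_mem_nhds (0 : ℂ) one_pos] with x hx
      rw [norm_pow, norm_pow]
      exact pow_le_pow_of_le_one (norm_nonneg x) (by simpa using hx) hm) tendsto_cuspParam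
  have hq (z : ℍ) : exp (2 * Real.pi * I * z) = cuspParam z ^ 13 := by
    rw [cuspParam, ← exp_nat_mul]; congr 1; push_cast; ring
  have hth (c : ℚ) (k : ℤ) (j : ℕ) (z : ℍ) (hc : c = 1 / 104 + j / 13) :
      (exp (2 * Real.pi * I * z / 104))⁻¹ * th13 c k z = cuspParam z ^ j +
        cuspParam z ^ j * ((∑' n : ℤ, (-1 : ℂ) ^ n *
          exp (2 * Real.pi * I * (((13 * n ^ 2 + k * n : ℤ) : ℂ) / 2) * z)) - 1) := by
    have : exp (2 * Real.pi * I * c * z) = exp (2 * Real.pi * I * z / 104) * cuspParam z ^ j := by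
      rw [cuspParam, ← exp_nat_mul, ← exp_add, hc]; congr 1; push_cast; ring
    rw [th13, this]
    field_simp [exp_ne_zero]
    ring
  have main {k : ℤ} {c : ℕ} (j : ℕ) (hc : 0 < c) (hk : |k| + 2 * c ≤ 13) (hj : 15 ≤ j + 13 * c) :
      (fun z : ℍ ↦ cuspParam z ^ j * ((∑' n : ℤ, (-1 : ℂ) ^ n *
          exp (2 * Real.pi * I * (((13 * n ^ 2 + k * n : ℤ) : ℂ) / 2) * z)) - 1)) =O[atImInfty]
        fun z ↦ cuspParam z ^ 15 := by
    refine ((isBigO_refl _ _).mul (isBigO_tsum_theta_sub_one hc hk)).trans ?_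
    simpa only [hq, ← pow_mul, ← pow_add] using hle hj
  rw [isBigO_pi]
  intro i
  fin_cases i
  · refine ((hle le_rfl).add (main (k := 11) (c := 1) 15 (by norm_num) (by norm_num)
      (by norm_num))).congr_left fun z ↦ ?_
    simp [AV, ta, leadVec, hth _ _ 15 z (show (121 / 104 : ℚ) = _ by norm_num)]
  · refine (main (k := 7) (c := 2) 6 (by norm_num) (by norm_num)
      (by norm_num)).congr_left fun z ↦ ?_
    simp [AV, ta, leadVec, hth _ _ 6 z (show (49 / 104 : ℚ) = _ by norm_num)]
  · refine (main (k := 5) (c := 2) 3 (by norm_num) (by norm_num)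
      (by norm_num)).congr_left fun z ↦ ?_
    simp [AV, ta, leadVec, hth _ _ 3 z (show (25 / 104 : ℚ) = _ by norm_num)]
  · refine (main (k := 3) (c := 2) 1 (by norm_num) (by norm_num)
      (by norm_num)).neg_left.congr_left fun z ↦ ?_
    simp [AV, ta, leadVec, hth _ _ 1 z (show (9 / 104 : ℚ) = _ by norm_num)]
  · refine (main (k := 9) (c := 2) 10 (by norm_num) (by norm_num)
      (by norm_num)).congr_left fun z ↦ ?_
    simp [AV, ta, leadVec, hth _ _ 10 z (show (81 / 104 : ℚ) = _ by norm_num)]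
  · refine (main (k := 1) (c := 2) 0 (by norm_num) (by norm_num)
      (by norm_num)).congr_left fun z ↦ ?_
    simp [AV, ta, leadVec, hth _ _ 0 z (show (104⁻¹ : ℚ) = _ by norm_num)]

lemma contDiff_dF (ν : ℕ) : ContDiff ℂ 1 (dF ν) := by
  unfold dF GG0 GG1 GG2 GG3 GG4 GG5 GG6 GG7 GG8 GG9 GG10 GG11 GG12
    DD0 DD1 DD2 DD3 DD4 DD5 DD6 DD7 DD8 DD9 DD10 DD11 DD12 DDinf
  fun_prop

lemma contDiff_dSum (k : ℕ) : ContDiff ℂ 1 (dSum k) := by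
  have : ContDiff ℂ 1 dInf := by
    unfold dInf GG0 DD0 DDinf
    fun_prop
  unfold dSum
  exact (ContDiff.sum fun ν _ ↦ (contDiff_dF ν).pow k).add (this.pow k)

lemma contDiff_wSum (k : ℕ) : ContDiff ℂ 1 (wSum k) := by
  unfold wSum wF wInf AA0 AA1 AA2 AA3 AA4 AA5 AA6
  fun_prop

lemma tendsto_dSum_AV {k e : ℕ} (he : e < 15) (hek : e < 22 * k) (h13 : 13 ∣ 4 * k + e)
    (hlow : ∀ i < e, 13 ∣ 4 * k + i → (dPoly ^ k).coeff i = 0) :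
    Tendsto (fun z : ℍ ↦ dSum k ((exp (2 * Real.pi * I * z / 104))⁻¹ • AV z) / cuspParam z ^ e)
      atImInfty (𝓝 (13 * (dPoly ^ k).coeff e)) := by
  obtain ⟨q, hq⟩ := exists_sum_zeta_pow_mul_eval (dPoly ^ k) h13 hlow
  have h := tendsto_div_pow_of_leadVec tendsto_cuspParam (fun z ↦ exp_ne_zero _) isBigO_AV
    (contDiff_dSum k) he
    (F := fun x ↦ 13 * (dPoly ^ k).coeff e + x * q.eval x + 13 ^ (2 * k) * x ^ (22 * k - e))
    (by fun_prop) fun x ↦ ?_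
  · simpa [(Nat.sub_pos_of_lt hek).ne'] using h
  · have h1 : dInf (leadVec x) ^ k = x ^ e * (13 ^ (2 * k) * x ^ (22 * k - e)) := by
      have : dInf (leadVec x) = 13 ^ 2 * x ^ 22 := by
        simp only [dInf, GG0, DD0, DDinf, leadVec, Matrix.cons_val]; ring
      rw [this, mul_left_comm, ← pow_add, Nat.add_sub_cancel' hek.le, mul_pow, pow_mul, pow_mul]
    have h2 (ν : ℕ) : dF ν (leadVec x) ^ k =
        (ζ ^ ν) ^ (4 * k) * (dPoly ^ k).eval (ζ ^ ν * x) := by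
      rw [dF_leadVec, mul_pow, Polynomial.eval_pow, pow_mul]
    rw [dSum, h1, mul_add, ← hq]
    simp only [h2]

lemma tendsto_wSum_AV {k e : ℕ} (he : e < 15) (hek : e < 6 * k) (h13 : 13 ∣ 7 * k + e)
    (hlow : ∀ i < e, 13 ∣ 7 * k + i → (wPoly ^ (2 * k)).coeff i = 0) :
    Tendsto (fun z : ℍ ↦ wSum k ((exp (2 * Real.pi * I * z / 104))⁻¹ • AV z) / cuspParam z ^ e)
      atImInfty (𝓝 (13 * (wPoly ^ (2 * k)).coeff e)) := by
  obtain ⟨q, hq⟩ := exists_sum_zeta_pow_mul_eval (wPoly ^ (2 * k)) h13 hlow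
  have h := tendsto_div_pow_of_leadVec tendsto_cuspParam (fun z ↦ exp_ne_zero _) isBigO_AV
    (contDiff_wSum k) he
    (F := fun x ↦ 13 * (wPoly ^ (2 * k)).coeff e + x * q.eval x +
      13 ^ k * x ^ (6 * k - e) * ((1 + x ^ 13) ^ 2) ^ k)
    (by fun_prop) fun x ↦ ?_
  · simpa [(Nat.sub_pos_of_lt hek).ne'] using h
  · have h1 : wInf (leadVec x) ^ k =
        x ^ e * (13 ^ k * x ^ (6 * k - e) * ((1 + x ^ 13) ^ 2) ^ k) := by
      have : wInf (leadVec x) = 13 * x ^ 6 * (1 + x ^ 13) ^ 2 := by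
        simp only [wInf, AA0, leadVec, Matrix.cons_val]; ring
      have hx : x ^ e * x ^ (6 * k - e) = (x ^ 6) ^ k := by
        rw [← pow_add, Nat.add_sub_cancel' hek.le, pow_mul]
      rw [this, mul_pow, mul_pow, ← hx]; ring
    have h2 (ν : ℕ) : wF ν (leadVec x) ^ k =
        (ζ ^ ν) ^ (7 * k) * (wPoly ^ (2 * k)).eval (ζ ^ ν * x) := by
      rw [wF_leadVec, mul_pow, Polynomial.eval_pow, ← pow_mul, ← pow_mul _ 2]
    rw [wSum, h1, mul_add, ← hq]
    simp only [h2]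

end Asymptotics

section Identification

open UpperHalfPlane hiding I
open ModularForm MatrixGroups Filter Topology

lemma differentiableAt_psi13 (b : ℤ) {z : ℂ} (hz : 0 < z.im) :
    DifferentiableAt ℂ (psi13 · b) z := by
  simp only [psi13_eq_jacobiTheta₂]
  have h13 : 0 < (13 * z).im := by simpa using hz
  have h := (hasFDerivAt_jacobiTheta₂ (-13 / 2 + (2 * b + 13) * z / 2) h13).differentiableAt
  have hin : DifferentiableAt ℂ (fun z : ℂ ↦ (-13 / 2 + (2 * b + 13) * z / 2, 13 * z)) z := by
    fun_prop
  exact DifferentiableAt.mul (by fun_prop) (h.comp (f := fun z : ℂ ↦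
    ((-13 / 2 + (2 * b + 13) * z / 2, 13 * z) : ℂ × ℂ)) z hin)

lemma differentiableAt_AV {z : ℂ} (hz : 0 < z.im) : DifferentiableAt ℂ AV z := by
  have h (a : ZMod 13) : DifferentiableAt ℂ (phi13 · a) z := differentiableAt_psi13 _ hz
  rw [show AV = fun z ↦ toVec (phi13 z) from funext AV_eq_toVec]
  simp only [toVec]
  rw [differentiableAt_pi]
  intro i
  fin_cases i
  exacts [h 1, h 3, (h 4).neg, (h 5).neg, (h 2).neg, (h 6).neg]

/-- A homogeneous form of degree `2 * n` in the theta vector which transforms like the `2 * n`-th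
power of a theta constant, divided by a power of the eta function, is determined by its leading
coefficient, provided that the weight `w` of the quotient is less than 12. -/
lemma form_AV_eq {P : (Fin 6 → ℂ) → ℂ} (hP : ContDiff ℂ 1 P) {n m w e : ℕ}
    (hsmul : ∀ c v, P (c • v) = (c ^ 2) ^ n * P v) (hT : ∀ z, P (AV (z + 1)) = I ^ n * P (AV z))
    (hS : ∀ z : ℂ, 0 < z.im → P (AV (-1 / z)) = (I * z) ^ n * P (AV z))
    (hn : n = w + m) (hm : 13 * m = 3 * n + 12 * e) (hw : w < 12) (g : ModularForm 𝒮ℒ w)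
    (hg : Tendsto g atImInfty (𝓝 1)) {c : ℂ}
    (hlim : Tendsto (fun z : ℍ ↦ P ((exp (2 * Real.pi * I * z / 104))⁻¹ • AV z) / cuspParam z ^ e)
      atImInfty (𝓝 c)) {z : ℂ} (hz : 0 < z.im) :
    P (AV z) = c * g ⟨z, hz⟩ * (etaF z ^ 2) ^ m := by
  have hη {z : ℂ} (hz : 0 < z.im) : (etaF z ^ 2) ^ m ≠ 0 :=
    pow_ne_zero _ (pow_ne_zero _ (etaF_ne_zero hz))
  rw [← div_eq_iff (hη hz)]
  have hphase : (exp (Real.pi * I / 12) ^ 2) ^ m = I ^ n := by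
    have h6 : exp (Real.pi * I / 12) ^ 6 = I := by
      rw [← exp_nat_mul]; convert exp_pi_div_two_mul_I using 2; push_cast; ring
    have h24 : exp (Real.pi * I / 12) ^ 24 = 1 := by
      rw [show 24 = 6 * 4 from rfl, pow_mul, h6, I_pow_four]
    calc _ = (exp (Real.pi * I / 12) ^ 2) ^ m * (exp (Real.pi * I / 12) ^ 24) ^ m := by
          rw [h24, one_pow, mul_one]
      _ = exp (Real.pi * I / 12) ^ (6 * n + 24 * e) := by
          rw [← pow_mul, ← pow_mul, ← pow_add]; congr 1; omega
      _ = I ^ n := by rw [pow_add, pow_mul, pow_mul, h6, h24, one_pow, mul_one]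
  have hphase' : (-I) ^ m = I ^ n := by
    obtain ⟨t, ht⟩ : 4 ∣ n + m := by omega
    have h1 : I ^ n * I ^ m = 1 := by rw [← pow_add, ht, pow_mul, I_pow_four, one_pow]
    have h2 : (-I) ^ m * I ^ m = 1 := by rw [← mul_pow]; simp
    exact mul_right_cancel₀ (pow_ne_zero m I_ne_zero) (h2.trans h1.symm)
  refine eq_of_levelOne hw (c • g) (f := fun z ↦ P (AV z) / (etaF z ^ 2) ^ m) (c := c)
    ?_ ?_ ?_ ?_ ?_ hz
  · simpa only [smul_eq_mul, mul_one] using! hg.const_smul c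
  · intro z hz
    have hη' := differentiableOn_etaF.differentiableAt (isOpen_upperHalfPlaneSet.mem_nhds hz)
    exact (((hP.differentiable one_ne_zero).differentiableAt.comp z (differentiableAt_AV hz)).div
      ((hη'.pow 2).pow m) (hη hz)).differentiableWithinAt
  · intro z hz
    rw [hT, etaF_add_one, mul_pow, mul_pow, hphase]
    exact mul_div_mul_left _ _ (pow_ne_zero n I_ne_zero)
  · intro z hz
    have hz0 : z ≠ 0 := fun h ↦ by simp [h] at hz
    have hI := pow_ne_zero n I_ne_zero
    have hη'' := hη hz
    rw [hS z hz, etaF_neg_inv_sq hz, mul_pow, mul_pow, mul_pow, hphase']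
    field_simp
    rw [hn, pow_add]
    ring
  · have h := hlim.div (((tendsto_tprod_one_sub_exp_pow).pow 2).pow m) (by simp)
    rw [one_pow, one_pow, div_one] at h
    refine h.congr fun z ↦ ?_
    have hs : (exp (2 * Real.pi * I * z / 24) ^ 2) ^ m =
        (exp (2 * Real.pi * I * z / 104) ^ 2) ^ n * cuspParam z ^ e := by
      simp only [cuspParam, ← exp_nat_mul, ← exp_add]
      congr 1
      have : (13 * m : ℂ) = 3 * n + 12 * e := by exact_mod_cast hm
      push_cast
      linear_combination (Real.pi * I * z / 78) * this
    simp only [Pi.div_apply]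
    rw [hsmul, inv_pow, inv_pow, etaF, mul_pow, mul_pow, hs]
    field_simp [exp_ne_zero]

lemma dSum_xV {k m w e : ℕ} (hn : 3 * k = w + m) (hm : 13 * m = 9 * k + 12 * e) (hw : w < 12)
    (g : ModularForm 𝒮ℒ w) (hg : Tendsto g atImInfty (𝓝 1)) (he : e < 13) (hk : 0 < k) {c : ℂ}
    (hc : (dPoly ^ k).coeff e = c) {z : ℂ} (hz : 0 < z.im) :
    dSum k (xV z) = 13 * c * g ⟨z, hz⟩ * etaF z ^ (6 * k + 2 * m) := by
  have h := form_AV_eq (contDiff_dSum k) (n := 3 * k)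
    (fun c v ↦ by rw [dSum_smul, ← pow_mul _ 3]) (fun z ↦ by rw [dSum_AV_add_one, ← pow_mul])
    (fun z hz ↦ by rw [dSum_AV_neg_inv k hz, ← pow_mul]) hn (by omega) hw g hg
    (tendsto_dSum_AV (e := e) (by omega) (by omega) (by omega) fun i _ _ ↦ by omega) hz
  rw [show xV z = etaF z • AV z from rfl, dSum_smul, h, hc]
  ring

lemma wSum_xV {k m w e : ℕ} (hn : 2 * k = w + m) (hm : 13 * m = 6 * k + 12 * e) (hw : w < 12)
    (g : ModularForm 𝒮ℒ w) (hg : Tendsto g atImInfty (𝓝 1)) (he : e < 15) (hek : e < 6 * k)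
    (hlow : ∀ i < e, 13 ∣ 7 * k + i → (wPoly ^ (2 * k)).coeff i = 0) {c : ℂ}
    (hc : (wPoly ^ (2 * k)).coeff e = c) {z : ℂ} (hz : 0 < z.im) :
    wSum k (xV z) = 13 * c * g ⟨z, hz⟩ * etaF z ^ (4 * k + 2 * m) := by
  have h := form_AV_eq (contDiff_wSum k) (n := 2 * k)
    (fun c v ↦ by rw [wSum_smul, ← pow_mul _ 2]) (fun z ↦ by rw [wSum_AV_add_one, ← pow_mul])
    (fun z hz ↦ by rw [wSum_AV_neg_inv k hz, ← pow_mul]) hn (by omega) hw g hg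
    (tendsto_wSum_AV (e := e) he hek (by omega) hlow) hz
  rw [show xV z = etaF z • AV z from rfl, wSum_smul, h, hc]
  ring

lemma Phi12_xV {z : ℂ} (hz : 0 < z.im) : Phi12 (xV z) = etaF z ^ 24 := by
  have h := dSum_xV (k := 2) (m := 6) (w := 0) (e := 5) rfl rfl (by norm_num) (const 1)
    tendsto_const_nhds (by norm_num) (by norm_num) coeff_dPoly_pow_2_5 hz
  rw [const_apply] at h
  rw [Phi12, ← dSum, h]
  ring

lemma Phi18_xV {z : ℂ} (hz : 0 < z.im) : Phi18 (xV z) = etaF z ^ 24 * E₆ ⟨z, hz⟩ := by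
  have h := dSum_xV (k := 3) (m := 3) (w := 6) (e := 1) rfl rfl (by norm_num) E₆
    (tendsto_E_atImInfty _ (by decide)) (by norm_num) (by norm_num) coeff_dPoly_pow_3_1 hz
  rw [Phi18, ← dSum, h]
  ring

lemma Phi30_xV {z : ℂ} (hz : 0 < z.im) : Phi30 (xV z) = etaF z ^ 48 * E₆ ⟨z, hz⟩ := by
  have h := dSum_xV (k := 5) (m := 9) (w := 6) (e := 6) rfl rfl (by norm_num) E₆
    (tendsto_E_atImInfty _ (by decide)) (by norm_num) (by norm_num) coeff_dPoly_pow_5_6 hz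
  rw [Phi30, ← dSum, h]
  ring

lemma Phi42_xV {z : ℂ} (hz : 0 < z.im) : Phi42 (xV z) = etaF z ^ 72 * E₆ ⟨z, hz⟩ := by
  have h := dSum_xV (k := 7) (m := 15) (w := 6) (e := 11) rfl rfl (by norm_num) E₆
    (tendsto_E_atImInfty _ (by decide)) (by norm_num) (by norm_num) coeff_dPoly_pow_7_11 hz
  rw [Phi42, ← dSum, h]
  ring

lemma Phi44_xV {z : ℂ} (hz : 0 < z.im) : Phi44 (xV z) = etaF z ^ 80 * E₄ ⟨z, hz⟩ := by
  have hlow (i : ℕ) (hi : i < 14) (h13 : 13 ∣ 7 * 11 + i) : (wPoly ^ (2 * 11)).coeff i = 0 := by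
    obtain rfl : i = 1 := by omega
    exact coeff_wPoly_pow_22_1
  have h := wSum_xV (k := 11) (m := 18) (w := 4) (e := 14) rfl rfl (by norm_num) E₄
    (tendsto_E_atImInfty _ (by decide)) (by norm_num) (by norm_num) hlow coeff_wPoly_pow_22_14 hz
  rw [Phi44, ← wSum, h]
  ring

end Identification

theorem stmt17 (z : ℂ) (hz : 0 < z.im) :
    (Phi44 (xV z)) ^ 3 - (Phi12 (xV z)) ^ 8 * (Phi18 (xV z)) ^ 2 = 1728 * (Phi12 (xV z)) ^ 11 ∧
    (Phi44 (xV z)) ^ 3 - (Phi12 (xV z)) ^ 6 * (Phi30 (xV z)) ^ 2 = 1728 * (Phi12 (xV z)) ^ 11 ∧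
    (Phi44 (xV z)) ^ 3 - (Phi12 (xV z)) ^ 4 * (Phi42 (xV z)) ^ 2 = 1728 * (Phi12 (xV z)) ^ 11 := by
  rw [Phi12_xV hz, Phi18_xV hz, Phi30_xV hz, Phi42_xV hz, Phi44_xV hz]
  refine ⟨?_, ?_, ?_⟩ <;> linear_combination etaF z ^ 240 * discriminant_etaF hz
end
end

section
/- Each of the seven polynomial functions Φ₁₂, Φ₁₈, Φ₂₀, Φ₃₀, Φ₃₂, Φ₄₂, Φ₄₄ on ℂ⁶ is invariant under the group G = ⟨S, T⟩ ⊂ GL(6,ℂ): for every v ∈ ℂ⁶ and each Φ ∈ {Φ₁₂, Φ₁₈, Φ₂₀, Φ₃₀, Φ₃₂, Φ₄₂, Φ₄₄}, one has Φ(S·v) = Φ(v) and Φ(T·v) = Φ(v). -/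
noncomputable section

open Complex

def Tmat : Matrix (Fin 6) (Fin 6) ℂ :=
  Matrix.diagonal ![ζ ^ 7, ζ ^ 11, ζ ^ 8, ζ ^ 6, ζ ^ 2, ζ ^ 5]

def Smat : Matrix (Fin 6) (Fin 6) ℂ :=
  (-(1 / (Real.sqrt 13 : ℂ))) •
    !![ζ ^ 12 - ζ, ζ ^ 10 - ζ ^ 3, ζ ^ 4 - ζ ^ 9, ζ ^ 5 - ζ ^ 8, ζ ^ 2 - ζ ^ 11, ζ ^ 6 - ζ ^ 7;
       ζ ^ 10 - ζ ^ 3, ζ ^ 4 - ζ ^ 9, ζ ^ 12 - ζ, ζ ^ 2 - ζ ^ 11, ζ ^ 6 - ζ ^ 7, ζ ^ 5 - ζ ^ 8;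
       ζ ^ 4 - ζ ^ 9, ζ ^ 12 - ζ, ζ ^ 10 - ζ ^ 3, ζ ^ 6 - ζ ^ 7, ζ ^ 5 - ζ ^ 8, ζ ^ 2 - ζ ^ 11;
       ζ ^ 5 - ζ ^ 8, ζ ^ 2 - ζ ^ 11, ζ ^ 6 - ζ ^ 7, ζ - ζ ^ 12, ζ ^ 3 - ζ ^ 10, ζ ^ 9 - ζ ^ 4;
       ζ ^ 2 - ζ ^ 11, ζ ^ 6 - ζ ^ 7, ζ ^ 5 - ζ ^ 8, ζ ^ 3 - ζ ^ 10, ζ ^ 9 - ζ ^ 4, ζ - ζ ^ 12;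
       ζ ^ 6 - ζ ^ 7, ζ ^ 5 - ζ ^ 8, ζ ^ 2 - ζ ^ 11, ζ ^ 9 - ζ ^ 4, ζ - ζ ^ 12, ζ ^ 3 - ζ ^ 10]

open Matrix

/-- The matrix `Smat` without its scalar factor. -/
def oddMat : Matrix (Fin 6) (Fin 6) ℂ :=
  !![ζ ^ 12 - ζ, ζ ^ 10 - ζ ^ 3, ζ ^ 4 - ζ ^ 9, ζ ^ 5 - ζ ^ 8, ζ ^ 2 - ζ ^ 11, ζ ^ 6 - ζ ^ 7;
     ζ ^ 10 - ζ ^ 3, ζ ^ 4 - ζ ^ 9, ζ ^ 12 - ζ, ζ ^ 2 - ζ ^ 11, ζ ^ 6 - ζ ^ 7, ζ ^ 5 - ζ ^ 8;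
     ζ ^ 4 - ζ ^ 9, ζ ^ 12 - ζ, ζ ^ 10 - ζ ^ 3, ζ ^ 6 - ζ ^ 7, ζ ^ 5 - ζ ^ 8, ζ ^ 2 - ζ ^ 11;
     ζ ^ 5 - ζ ^ 8, ζ ^ 2 - ζ ^ 11, ζ ^ 6 - ζ ^ 7, ζ - ζ ^ 12, ζ ^ 3 - ζ ^ 10, ζ ^ 9 - ζ ^ 4;
     ζ ^ 2 - ζ ^ 11, ζ ^ 6 - ζ ^ 7, ζ ^ 5 - ζ ^ 8, ζ ^ 3 - ζ ^ 10, ζ ^ 9 - ζ ^ 4, ζ - ζ ^ 12;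
     ζ ^ 6 - ζ ^ 7, ζ ^ 5 - ζ ^ 8, ζ ^ 2 - ζ ^ 11, ζ ^ 9 - ζ ^ 4, ζ - ζ ^ 12, ζ ^ 3 - ζ ^ 10]

/-- The quadratic Gauss sum modulo 13. -/
def gauss : ℂ :=
  ζ + ζ ^ 3 + ζ ^ 4 + ζ ^ 9 + ζ ^ 10 + ζ ^ 12 - (ζ ^ 2 + ζ ^ 5 + ζ ^ 6 + ζ ^ 7 + ζ ^ 8 + ζ ^ 11)

/-- A generator of the torus normalising `⟨Tmat⟩`. -/
def torusMat : Matrix (Fin 6) (Fin 6) ℂ :=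
  !![0, 0, 0, 0, 0, 1; 0, 0, 0, 1, 0, 0; 0, 0, 0, 0, 1, 0;
     0, 0, -1, 0, 0, 0; -1, 0, 0, 0, 0, 0; 0, -1, 0, 0, 0, 0]

theorem isPrimitiveRoot_zeta : IsPrimitiveRoot ζ 13 := by
  simpa [ζ] using Complex.isPrimitiveRoot_exp 13 (by norm_num)

theorem zeta_pow_eq_mod (n : ℕ) (_ : 13 ≤ n) : ζ ^ n = ζ ^ (n % 13) :=
  pow_eq_pow_mod n isPrimitiveRoot_zeta.pow_eq_one

theorem zeta_pow_twelve :
    ζ ^ 12 = -(1 + ζ + ζ ^ 2 + ζ ^ 3 + ζ ^ 4 + ζ ^ 5 + ζ ^ 6 + ζ ^ 7 + ζ ^ 8 + ζ ^ 9 + ζ ^ 10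
      + ζ ^ 11) := by
  have h := isPrimitiveRoot_zeta.geom_sum_eq_zero (by norm_num)
  simp only [Finset.sum_range_succ, Finset.sum_range_zero] at h
  linear_combination h
theorem gauss_sq : gauss ^ 2 = 13 := by
  unfold gauss
  ring_nf
  simp only [zeta_pow_eq_mod, zeta_pow_twelve, Nat.reduceLeDiff, Nat.reduceMod]
  ring

theorem Tmat_pow (n : ℕ) :
    Tmat ^ n = diagonal ![ζ ^ (7 * n % 13), ζ ^ (11 * n % 13), ζ ^ (8 * n % 13),
      ζ ^ (6 * n % 13), ζ ^ (2 * n % 13), ζ ^ (5 * n % 13)] := by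
  rw [Tmat, diagonal_pow]
  congr 1
  funext i
  fin_cases i <;> simp [← pow_mul] <;> exact pow_eq_pow_mod _ isPrimitiveRoot_zeta.pow_eq_one

theorem Tmat_pow_mod (n : ℕ) : Tmat ^ n = Tmat ^ (n % 13) := by
  simp [Tmat_pow, Nat.mul_mod]

theorem oddMat_mul_self : oddMat * oddMat = (-13 : ℂ) • (1 : Matrix (Fin 6) (Fin 6) ℂ) := by
  ext i j
  simp only [Matrix.smul_apply, mul_apply, Fin.sum_univ_six]
  fin_cases i <;> fin_cases j <;> simp [oddMat, one_apply] <;> ring_nf <;>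
    simp only [zeta_pow_eq_mod, zeta_pow_twelve, Nat.reduceLeDiff, Nat.reduceMod] <;> ring

set_option maxHeartbeats 2000000 in
theorem oddMat_mul_Tmat_mul_oddMat :
    oddMat * Tmat * oddMat = -gauss • (Tmat ^ 12 * oddMat * Tmat ^ 12) := by
  ext i j
  rw [Tmat_pow, Tmat]
  simp only [Matrix.smul_apply, mul_diagonal, diagonal_mul, mul_apply (M := oddMat * _),
    Fin.sum_univ_six]
  fin_cases i <;> fin_cases j <;> simp [oddMat, gauss] <;> ring_nf <;>
    simp only [zeta_pow_eq_mod, zeta_pow_twelve, Nat.reduceLeDiff, Nat.reduceMod] <;> ring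

theorem torusMat_mul_oddMat : torusMat * oddMat = oddMat * torusMatᵀ := by
  ext i j
  fin_cases i <;> fin_cases j <;> simp [oddMat, torusMat, mul_apply, Fin.sum_univ_six]

set_option maxHeartbeats 2000000 in
theorem oddMat_mul_Tmat_sq_mul_oddMat :
    oddMat * Tmat ^ 2 * oddMat = gauss • (Tmat ^ 6 * (torusMat * oddMat) * Tmat ^ 6) := by
  ext i j
  rw [Tmat_pow, Tmat_pow, torusMat_mul_oddMat]
  simp only [Matrix.smul_apply, mul_diagonal, diagonal_mul, mul_apply (M := oddMat * _),
    Fin.sum_univ_six]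
  fin_cases i <;> fin_cases j <;>
    simp [oddMat, gauss, torusMat, mul_apply, Fin.sum_univ_six] <;> ring_nf <;>
    simp only [zeta_pow_eq_mod, zeta_pow_twelve, Nat.reduceLeDiff, Nat.reduceMod] <;> ring

theorem torusMat_mul_transpose : torusMat * torusMatᵀ = 1 := by
  ext i j
  fin_cases i <;> fin_cases j <;> simp [torusMat, mul_apply, Fin.sum_univ_six]

theorem torusMat_mul_Tmat : torusMat * Tmat = Tmat ^ 10 * torusMat := by
  rw [Tmat_pow, Tmat]
  ext i j
  fin_cases i <;> fin_cases j <;> simp [torusMat]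
theorem ofReal_sqrt_thirteen_sq : ((Real.sqrt 13 : ℝ) : ℂ) ^ 2 = 13 := by
  rw [← Complex.ofReal_pow, Real.sq_sqrt (by norm_num)]
  norm_num

theorem Smat_eq_smul_oddMat : Smat = (-(1 / (Real.sqrt 13 : ℂ))) • oddMat := rfl

theorem oddMat_eq_smul_Smat : oddMat = (-(Real.sqrt 13 : ℂ)) • Smat := by
  have hs : (Real.sqrt 13 : ℂ) ≠ 0 := by
    intro h
    simpa [h] using ofReal_sqrt_thirteen_sq
  rw [Smat_eq_smul_oddMat, smul_smul]
  field_simp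
  simp

theorem Smat_mul_mul_Smat (A : Matrix (Fin 6) (Fin 6) ℂ) :
    Smat * A * Smat = (1 / 13 : ℂ) • (oddMat * A * oddMat) := by
  simp only [Smat_eq_smul_oddMat, Matrix.smul_mul, Matrix.mul_smul, smul_smul]
  congr 1
  rw [← ofReal_sqrt_thirteen_sq]
  ring

theorem Smat_mul_Smat : Smat * Smat = -1 := by
  have h := Smat_mul_mul_Smat 1
  rw [mul_one, mul_one, oddMat_mul_self, smul_smul] at h
  rw [h]
  norm_num

theorem torusMat_mul_Smat : torusMat * Smat = Smat * torusMatᵀ := by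
  simp only [Smat_eq_smul_oddMat, Matrix.smul_mul, Matrix.mul_smul, torusMat_mul_oddMat]

theorem torusMat_mul_Smat_mul_torusMat : torusMat * (Smat * torusMat) = Smat := by
  rw [← mul_assoc, torusMat_mul_Smat, mul_assoc, mul_eq_one_comm.mp torusMat_mul_transpose,
    mul_one]

theorem torusMat_mul_Tmat_pow (n : ℕ) : torusMat * Tmat ^ n = Tmat ^ (10 * n) * torusMat := by
  rw [pow_mul]
  exact (SemiconjBy.pow_right (a := torusMat) torusMat_mul_Tmat n)

/-- Invariance under the monomial matrices `-1`, `Tmat` and `torusMat`. -/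
structure IsMonomialInvariant (F : (Fin 6 → ℂ) → ℂ) : Prop where
  neg (v : Fin 6 → ℂ) : F (-v) = F v
  Tmat_mulVec (v : Fin 6 → ℂ) : F (Tmat *ᵥ v) = F v
  torusMat_mulVec (v : Fin 6 → ℂ) : F (torusMat *ᵥ v) = F v

namespace IsMonomialInvariant

variable {F : (Fin 6 → ℂ) → ℂ}

theorem smul (hF : IsMonomialInvariant F) {c : ℂ} (hc : c ^ 2 = 1) (v : Fin 6 → ℂ) :
    F (c • v) = F v := by
  rcases sq_eq_one_iff.mp hc with rfl | rfl <;> simp [hF.neg]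

theorem Tmat_pow_mulVec (hF : IsMonomialInvariant F) (n : ℕ) (v : Fin 6 → ℂ) :
    F ((Tmat ^ n) *ᵥ v) = F v := by
  induction n with
  | zero => simp
  | succ n ih => rw [pow_succ', ← mulVec_mulVec, hF.Tmat_mulVec, ih]

theorem Smat_torusMat_mulVec (hF : IsMonomialInvariant F) (v : Fin 6 → ℂ) :
    F ((Smat * torusMat) *ᵥ v) = F (Smat *ᵥ v) := by
  rw [← hF.torusMat_mulVec, mulVec_mulVec, torusMat_mul_Smat_mul_torusMat]

theorem Smat_Tmat_Smat (hF : IsMonomialInvariant F) (v : Fin 6 → ℂ) :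
    F ((Smat * Tmat ^ 1 * Smat) *ᵥ v) = F ((Smat * Tmat ^ 12) *ᵥ v) := by
  rw [Smat_mul_mul_Smat, pow_one, oddMat_mul_Tmat_mul_oddMat, oddMat_eq_smul_Smat, Matrix.mul_smul,
    Matrix.smul_mul, smul_smul, smul_smul, smul_mulVec, hF.smul, mul_assoc, ← mulVec_mulVec,
    hF.Tmat_pow_mulVec]
  linear_combination (1 / 169) * gauss ^ 2 * ofReal_sqrt_thirteen_sq + (1 / 13) * gauss_sq

theorem Smat_Tmat_sq_Smat (hF : IsMonomialInvariant F) (v : Fin 6 → ℂ) :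
    F ((Smat * Tmat ^ 2 * Smat) *ᵥ v) = F ((Smat * Tmat ^ 6) *ᵥ v) := by
  rw [Smat_mul_mul_Smat, oddMat_mul_Tmat_sq_mul_oddMat, oddMat_eq_smul_Smat, Matrix.mul_smul,
    Matrix.mul_smul, Matrix.smul_mul, smul_smul, smul_smul, smul_mulVec, hF.smul, mul_assoc,
    mul_assoc, ← mulVec_mulVec, hF.Tmat_pow_mulVec, ← mulVec_mulVec, hF.torusMat_mulVec]
  linear_combination (1 / 169) * gauss ^ 2 * ofReal_sqrt_thirteen_sq + (1 / 13) * gauss_sq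

theorem Smat_Tmat_pow_Smat_step (hF : IsMonomialInvariant F) {n m n' m' : ℕ}
    (h : ∀ v, F ((Smat * Tmat ^ n * Smat) *ᵥ v) = F ((Smat * Tmat ^ m) *ᵥ v))
    (hn : 10 * n % 13 = n' % 13) (hm : m % 13 = 10 * m' % 13) (v : Fin 6 → ℂ) :
    F ((Smat * Tmat ^ n' * Smat) *ᵥ v) = F ((Smat * Tmat ^ m') *ᵥ v) := by
  have hn : Smat * Tmat ^ n' * Smat =
      Smat * torusMat * (Tmat ^ n * Smat * torusMat) := by
    rw [Tmat_pow_mod n', ← hn, ← Tmat_pow_mod]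
    nth_rw 2 [← torusMat_mul_Smat_mul_torusMat]
    rw [← mul_assoc, ← mul_assoc, mul_assoc Smat (Tmat ^ _), ← torusMat_mul_Tmat_pow]
    simp only [mul_assoc]
  have hm : Tmat ^ m * torusMat = torusMat * Tmat ^ m' := by
    rw [Tmat_pow_mod m, hm, ← Tmat_pow_mod, torusMat_mul_Tmat_pow]
  rw [hn, ← mulVec_mulVec, hF.Smat_torusMat_mulVec, mulVec_mulVec, ← mul_assoc, ← mul_assoc,
    ← mulVec_mulVec, h, mulVec_mulVec, mul_assoc, hm, ← mul_assoc, ← mulVec_mulVec,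
    hF.Smat_torusMat_mulVec, mulVec_mulVec]

/-- The averaging argument: the functions `f ν = F ∘ (Smat * Tmat ^ ν)` together with `F` are
permuted by `Smat` and by `Tmat`. -/
theorem sum_pow_Smat_mulVec (hF : IsMonomialInvariant F) {f : ℕ → (Fin 6 → ℂ) → ℂ}
    (h0 : ∀ v, F (Smat *ᵥ v) = f 0 v) (hf : ∀ ν v, f ν (Tmat *ᵥ v) = f (ν + 1) v) (k : ℕ)
    (v : Fin 6 → ℂ) :
    (∑ ν ∈ Finset.range 13, f ν (Smat *ᵥ v) ^ k) + F (Smat *ᵥ v) ^ k =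
      (∑ ν ∈ Finset.range 13, f ν v ^ k) + F v ^ k := by
  have hfF (ν : ℕ) : ∀ v, f ν v = F ((Smat * Tmat ^ ν) *ᵥ v) := by
    induction ν with
    | zero => simp [h0]
    | succ ν ih =>
      intro v
      rw [← hf, ih, mulVec_mulVec, pow_succ, mul_assoc]
  have g1 := hF.Smat_Tmat_Smat
  have g10 := hF.Smat_Tmat_pow_Smat_step (n' := 10) (m' := 9) g1 (by rfl) (by rfl)
  have g9 := hF.Smat_Tmat_pow_Smat_step (n' := 9) (m' := 10) g10 (by rfl) (by rfl)
  have g12 := hF.Smat_Tmat_pow_Smat_step (n' := 12) (m' := 1) g9 (by rfl) (by rfl)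
  have g3 := hF.Smat_Tmat_pow_Smat_step (n' := 3) (m' := 4) g12 (by rfl) (by rfl)
  have g4 := hF.Smat_Tmat_pow_Smat_step (n' := 4) (m' := 3) g3 (by rfl) (by rfl)
  have g2 := hF.Smat_Tmat_sq_Smat
  have g7 := hF.Smat_Tmat_pow_Smat_step (n' := 7) (m' := 11) g2 (by rfl) (by rfl)
  have g5 := hF.Smat_Tmat_pow_Smat_step (n' := 5) (m' := 5) g7 (by rfl) (by rfl)
  have g11 := hF.Smat_Tmat_pow_Smat_step (n' := 11) (m' := 7) g5 (by rfl) (by rfl)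
  have g6 := hF.Smat_Tmat_pow_Smat_step (n' := 6) (m' := 2) g11 (by rfl) (by rfl)
  have g8 := hF.Smat_Tmat_pow_Smat_step (n' := 8) (m' := 8) g6 (by rfl) (by rfl)
  have g0 : F ((Smat * Tmat ^ 0 * Smat) *ᵥ v) = F v := by
    rw [pow_zero, mul_one, Smat_mul_Smat, neg_mulVec, one_mulVec, hF.neg]
  simp only [Finset.sum_range_succ, Finset.sum_range_zero, hfF, mulVec_mulVec, g0, g1, g2, g3, g4,
    g5, g6, g7, g8, g9, g10, g11, g12]
  rw [pow_zero, mul_one]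
  ring

theorem sum_pow_Tmat_mulVec (hF : IsMonomialInvariant F) {f : ℕ → (Fin 6 → ℂ) → ℂ}
    (hf : ∀ ν v, f ν (Tmat *ᵥ v) = f (ν + 1) v) (hf13 : ∀ v, f 13 v = f 0 v) (k : ℕ)
    (v : Fin 6 → ℂ) :
    (∑ ν ∈ Finset.range 13, f ν (Tmat *ᵥ v) ^ k) + F (Tmat *ᵥ v) ^ k =
      (∑ ν ∈ Finset.range 13, f ν v ^ k) + F v ^ k := by
  rw [hF.Tmat_mulVec]
  congr 1
  simp only [hf]
  rw [Finset.sum_range_succ, Finset.sum_range_succ' _ 12, hf13]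

end IsMonomialInvariant

theorem Tmat_mulVec_apply (v : Fin 6 → ℂ) :
    Tmat *ᵥ v =
      ![ζ ^ 7 * v 0, ζ ^ 11 * v 1, ζ ^ 8 * v 2, ζ ^ 6 * v 3, ζ ^ 2 * v 4, ζ ^ 5 * v 5] := by
  ext i
  fin_cases i <;> simp [Tmat, mulVec_diagonal]

theorem torusMat_mulVec_apply (v : Fin 6 → ℂ) :
    torusMat *ᵥ v = ![v 5, v 3, v 4, -v 2, -v 0, -v 1] := by
  ext i
  fin_cases i <;> simp [torusMat, mulVec, dotProduct, Fin.sum_univ_six]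

theorem torusMat_transpose_mulVec_apply (v : Fin 6 → ℂ) :
    torusMatᵀ *ᵥ v = ![-v 4, -v 5, -v 3, v 1, v 2, v 0] := by
  ext i
  fin_cases i <;> simp [torusMat, mulVec, dotProduct, Fin.sum_univ_six]

/-- The quadratic forms are eigenfunctions of `Tmat`. -/
theorem AA_Tmat_mulVec (v : Fin 6 → ℂ) :
    AA0 (Tmat *ᵥ v) = AA0 v ∧
    AA1 (Tmat *ᵥ v) = ζ * AA1 v ∧
    AA2 (Tmat *ᵥ v) = ζ ^ 4 * AA2 v ∧
    AA3 (Tmat *ᵥ v) = ζ ^ 9 * AA3 v ∧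
    AA4 (Tmat *ᵥ v) = ζ ^ 3 * AA4 v ∧
    AA5 (Tmat *ᵥ v) = ζ ^ 12 * AA5 v ∧
    AA6 (Tmat *ᵥ v) = ζ ^ 10 * AA6 v := by
  rw [Tmat_mulVec_apply]
  refine ⟨?_, ?_, ?_, ?_, ?_, ?_, ?_⟩ <;>
    simp only [AA0, AA1, AA2, AA3, AA4, AA5, AA6, cons_val] <;> ring_nf <;>
    simp only [zeta_pow_eq_mod, Nat.reduceLeDiff, Nat.reduceMod] <;> ring

/-- The cubic forms are eigenfunctions of `Tmat`. -/
theorem DD_Tmat_mulVec (v : Fin 6 → ℂ) :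
    DD0 (Tmat *ᵥ v) = DD0 v ∧
    DD1 (Tmat *ᵥ v) = ζ * DD1 v ∧
    DD2 (Tmat *ᵥ v) = ζ ^ 2 * DD2 v ∧
    DD3 (Tmat *ᵥ v) = ζ ^ 3 * DD3 v ∧
    DD4 (Tmat *ᵥ v) = ζ ^ 4 * DD4 v ∧
    DD5 (Tmat *ᵥ v) = ζ ^ 5 * DD5 v ∧
    DD6 (Tmat *ᵥ v) = ζ ^ 6 * DD6 v ∧
    DD7 (Tmat *ᵥ v) = ζ ^ 7 * DD7 v ∧
    DD8 (Tmat *ᵥ v) = ζ ^ 8 * DD8 v ∧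
    DD9 (Tmat *ᵥ v) = ζ ^ 9 * DD9 v ∧
    DD10 (Tmat *ᵥ v) = ζ ^ 10 * DD10 v ∧
    DD11 (Tmat *ᵥ v) = ζ ^ 11 * DD11 v ∧
    DD12 (Tmat *ᵥ v) = ζ ^ 12 * DD12 v ∧
    DDinf (Tmat *ᵥ v) = DDinf v := by
  rw [Tmat_mulVec_apply]
  refine ⟨?_, ?_, ?_, ?_, ?_, ?_, ?_, ?_, ?_, ?_, ?_, ?_, ?_, ?_⟩ <;>
    simp only [DD0, DD1, DD2, DD3, DD4, DD5, DD6, DD7, DD8, DD9, DD10, DD11, DD12, DDinf,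
      cons_val] <;> ring_nf <;>
    simp only [zeta_pow_eq_mod, Nat.reduceLeDiff, Nat.reduceMod] <;> ring

/-- The sextic forms are eigenfunctions of `Tmat`. -/
theorem GG_Tmat_mulVec (v : Fin 6 → ℂ) :
    GG0 (Tmat *ᵥ v) = GG0 v ∧
    GG1 (Tmat *ᵥ v) = ζ * GG1 v ∧
    GG2 (Tmat *ᵥ v) = ζ ^ 2 * GG2 v ∧
    GG3 (Tmat *ᵥ v) = ζ ^ 3 * GG3 v ∧
    GG4 (Tmat *ᵥ v) = ζ ^ 4 * GG4 v ∧
    GG5 (Tmat *ᵥ v) = ζ ^ 5 * GG5 v ∧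
    GG6 (Tmat *ᵥ v) = ζ ^ 6 * GG6 v ∧
    GG7 (Tmat *ᵥ v) = ζ ^ 7 * GG7 v ∧
    GG8 (Tmat *ᵥ v) = ζ ^ 8 * GG8 v ∧
    GG9 (Tmat *ᵥ v) = ζ ^ 9 * GG9 v ∧
    GG10 (Tmat *ᵥ v) = ζ ^ 10 * GG10 v ∧
    GG11 (Tmat *ᵥ v) = ζ ^ 11 * GG11 v ∧
    GG12 (Tmat *ᵥ v) = ζ ^ 12 * GG12 v := by
  obtain ⟨h0, h1, h2, h3, h4, h5, h6, h7, h8, h9, h10, h11, h12, hinf⟩ := DD_Tmat_mulVec v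
  refine ⟨?_, ?_, ?_, ?_, ?_, ?_, ?_, ?_, ?_, ?_, ?_, ?_, ?_⟩ <;>
    simp only [GG0, GG1, GG2, GG3, GG4, GG5, GG6, GG7, GG8, GG9, GG10, GG11, GG12, h0, h1, h2, h3,
      h4, h5, h6, h7, h8, h9, h10, h11, h12, hinf] <;> ring_nf <;>
    simp only [zeta_pow_eq_mod, Nat.reduceLeDiff, Nat.reduceMod] <;> ring

theorem wF_Tmat_mulVec (ν : ℕ) (v : Fin 6 → ℂ) : wF ν (Tmat *ᵥ v) = wF (ν + 1) v := by
  obtain ⟨h0, h1, h2, h3, h4, h5, h6⟩ := AA_Tmat_mulVec v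
  simp only [wF, h0, h1, h2, h3, h4, h5, h6]
  ring

theorem dF_Tmat_mulVec (ν : ℕ) (v : Fin 6 → ℂ) : dF ν (Tmat *ᵥ v) = dF (ν + 1) v := by
  obtain ⟨h0, h1, h2, h3, h4, h5, h6, h7, h8, h9, h10, h11, h12⟩ := GG_Tmat_mulVec v
  simp only [dF, h0, h1, h2, h3, h4, h5, h6, h7, h8, h9, h10, h11, h12]
  ring

theorem wF_thirteen (v : Fin 6 → ℂ) : wF 13 v = wF 0 v := by
  simp [wF, zeta_pow_eq_mod]

theorem dF_thirteen (v : Fin 6 → ℂ) : dF 13 v = dF 0 v := by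
  simp [dF, zeta_pow_eq_mod]

theorem isMonomialInvariant_wInf : IsMonomialInvariant wInf where
  neg v := by simp [wInf, AA0]
  Tmat_mulVec v := by rw [wInf, (AA_Tmat_mulVec v).1, wInf]
  torusMat_mulVec v := by
    rw [torusMat_mulVec_apply]
    simp only [wInf, AA0, cons_val]
    ring

theorem isMonomialInvariant_dInf : IsMonomialInvariant dInf where
  neg v := by simp [dInf, GG0, DD0, DDinf]
  Tmat_mulVec v := by rw [dInf, (GG_Tmat_mulVec v).1, dInf]
  torusMat_mulVec v := by
    rw [torusMat_mulVec_apply]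
    simp only [dInf, GG0, DD0, DDinf, cons_val]
    ring

set_option maxRecDepth 10000 in
theorem AA0_oddMat_mulVec (v : Fin 6 → ℂ) :
    AA0 (oddMat *ᵥ v) =
      gauss * (AA0 v + AA1 v + AA2 v + AA3 v + AA4 v + AA5 v + AA6 v) := by
  simp only [AA0, AA1, AA2, AA3, AA4, AA5, AA6, mulVec, dotProduct, Fin.sum_univ_six, oddMat,
    gauss]
  simp
  ring_nf
  simp only [zeta_pow_eq_mod, zeta_pow_twelve, Nat.reduceLeDiff, Nat.reduceMod]
  ring

theorem wInf_Smat_mulVec (v : Fin 6 → ℂ) : wInf (Smat *ᵥ v) = wF 0 v := by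
  have hs (u : Fin 6 → ℂ) : wInf (Smat *ᵥ u) = (1 / 13) * AA0 (oddMat *ᵥ u) ^ 2 := by
    have h : wInf (oddMat *ᵥ u) = 169 * wInf (Smat *ᵥ u) := by
      have h4 : (√13 : ℂ) ^ 4 = 169 := by
        linear_combination (√13 ^ 2 + 13 : ℂ) * ofReal_sqrt_thirteen_sq
      rw [oddMat_eq_smul_Smat, smul_mulVec, ← h4]
      simp only [wInf, AA0, Pi.smul_apply, smul_eq_mul]
      ring
    rw [wInf] at h
    linear_combination (-1 / 169) * h
  rw [hs, AA0_oddMat_mulVec]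
  simp only [wF, mul_zero, pow_zero, one_mul]
  linear_combination (1 / 13) *
    (AA0 v + AA1 v + AA2 v + AA3 v + AA4 v + AA5 v + AA6 v) ^ 2 * gauss_sq

/-- The first of the two Gaussian periods of order three in terms of which the action of `Smat` on
cubic forms is written. -/
def periodP : ℂ := ζ ^ 12 - ζ + (ζ ^ 10 - ζ ^ 3) + (ζ ^ 4 - ζ ^ 9)

/-- The second of the two Gaussian periods of order three. -/
def periodQ : ℂ := ζ ^ 5 - ζ ^ 8 + (ζ ^ 2 - ζ ^ 11) + (ζ ^ 6 - ζ ^ 7)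

theorem two_mul_periodP_sq : 2 * periodP ^ 2 = -13 + 3 * (periodP * periodQ) := by
  simp only [periodP, periodQ]
  ring_nf
  simp only [zeta_pow_eq_mod, zeta_pow_twelve, Nat.reduceLeDiff, Nat.reduceMod]
  ring

theorem two_mul_periodQ_sq : 2 * periodQ ^ 2 = -13 - 3 * (periodP * periodQ) := by
  simp only [periodP, periodQ]
  ring_nf
  simp only [zeta_pow_eq_mod, zeta_pow_twelve, Nat.reduceLeDiff, Nat.reduceMod]
  ring

set_option maxRecDepth 100000 in
set_option maxHeartbeats 4000000 in
theorem DD0_oddMat_mulVec (v : Fin 6 → ℂ) :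
    DD0 (oddMat *ᵥ v) =
      (-2 * periodP - 3 * periodQ) * DD0 v + (periodQ - periodP) * (DD1 v + DD3 v + DD9 v)
        - periodP * (DD2 v + DD5 v + DD6 v) + (periodP + periodQ) * (DD4 v + DD10 v + DD12 v)
        + periodQ * (DD7 v + DD8 v + DD11 v) + (3 * periodP - 2 * periodQ) * DDinf v := by
  simp only [DD0, DD1, DD2, DD3, DD4, DD5, DD6, DD7, DD8, DD9, DD10, DD11, DD12, DDinf, mulVec,
    dotProduct, Fin.sum_univ_six, oddMat, periodP, periodQ]
  simp
  ring_nf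
  simp only [zeta_pow_eq_mod, zeta_pow_twelve, Nat.reduceLeDiff, Nat.reduceMod]
  ring

theorem DDinf_oddMat_mulVec (v : Fin 6 → ℂ) :
    DDinf (oddMat *ᵥ v) =
      (3 * periodP - 2 * periodQ) * DD0 v - (periodP + periodQ) * (DD1 v + DD3 v + DD9 v)
        - periodQ * (DD2 v + DD5 v + DD6 v) + (periodQ - periodP) * (DD4 v + DD10 v + DD12 v)
        - periodP * (DD7 v + DD8 v + DD11 v) + (2 * periodP + 3 * periodQ) * DDinf v := by
  have h : DDinf (oddMat *ᵥ v) = DD0 (oddMat *ᵥ (torusMatᵀ *ᵥ v)) := by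
    rw [mulVec_mulVec, ← torusMat_mul_oddMat, ← mulVec_mulVec, torusMat_mulVec_apply]
    simp only [DD0, DDinf, cons_val]
    ring
  rw [h, DD0_oddMat_mulVec, torusMat_transpose_mulVec_apply]
  simp only [DD0, DD1, DD2, DD3, DD4, DD5, DD6, DD7, DD8, DD9, DD10, DD11, DD12, DDinf, cons_val]
  ring

theorem GG0_oddMat_mulVec (v : Fin 6 → ℂ) :
    GG0 (oddMat *ᵥ v) = 13 * dF 0 v := by
  simp only [GG0, DD0_oddMat_mulVec, DDinf_oddMat_mulVec, dF, mul_zero, pow_zero, one_mul, GG1,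
    GG2, GG3, GG4, GG5, GG6, GG7, GG8, GG9, GG10, GG11, GG12]
  linear_combination (1 / 2) *
      ((-2 * DD0 v - (DD1 v + DD3 v + DD9 v) - (DD2 v + DD5 v + DD6 v)
          + (DD4 v + DD10 v + DD12 v) + 3 * DDinf v) ^ 2
        + (3 * DD0 v - (DD1 v + DD3 v + DD9 v) - (DD4 v + DD10 v + DD12 v) - (DD7 v + DD8 v + DD11 v)
          + 2 * DDinf v) ^ 2) * two_mul_periodP_sq
    + (1 / 2) *
      ((-3 * DD0 v + (DD1 v + DD3 v + DD9 v) + (DD4 v + DD10 v + DD12 v)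
          + (DD7 v + DD8 v + DD11 v) - 2 * DDinf v) ^ 2
        + (-2 * DD0 v - (DD1 v + DD3 v + DD9 v) - (DD2 v + DD5 v + DD6 v) + (DD4 v + DD10 v + DD12 v)
          + 3 * DDinf v) ^ 2) * two_mul_periodQ_sq

theorem dInf_Smat_mulVec (v : Fin 6 → ℂ) : dInf (Smat *ᵥ v) = dF 0 v := by
  have h : GG0 (oddMat *ᵥ v) = 13 ^ 3 * GG0 (Smat *ᵥ v) := by
    have h6 : (√13 : ℂ) ^ 6 = 13 ^ 3 := by
      rw [← ofReal_sqrt_thirteen_sq, ← pow_mul]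
    rw [oddMat_eq_smul_Smat, smul_mulVec, ← h6]
    simp only [GG0, DD0, DDinf, Pi.smul_apply, smul_eq_mul]
    ring
  rw [GG0_oddMat_mulVec] at h
  rw [dInf]
  linear_combination (-1 / 13) * h

theorem stmt18 (v : Fin 6 → ℂ) :
    Phi12 (Matrix.mulVec Smat v) = Phi12 v ∧ Phi12 (Matrix.mulVec Tmat v) = Phi12 v ∧
    Phi18 (Matrix.mulVec Smat v) = Phi18 v ∧ Phi18 (Matrix.mulVec Tmat v) = Phi18 v ∧
    Phi20 (Matrix.mulVec Smat v) = Phi20 v ∧ Phi20 (Matrix.mulVec Tmat v) = Phi20 v ∧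
    Phi30 (Matrix.mulVec Smat v) = Phi30 v ∧ Phi30 (Matrix.mulVec Tmat v) = Phi30 v ∧
    Phi32 (Matrix.mulVec Smat v) = Phi32 v ∧ Phi32 (Matrix.mulVec Tmat v) = Phi32 v ∧
    Phi42 (Matrix.mulVec Smat v) = Phi42 v ∧ Phi42 (Matrix.mulVec Tmat v) = Phi42 v ∧
    Phi44 (Matrix.mulVec Smat v) = Phi44 v ∧ Phi44 (Matrix.mulVec Tmat v) = Phi44 v := by
  refine ⟨?_, ?_, ?_, ?_, ?_, ?_, ?_, ?_, ?_, ?_, ?_, ?_, ?_, ?_⟩ <;>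
    simp only [Phi12, Phi18, Phi20, Phi30, Phi32, Phi42, Phi44,
      isMonomialInvariant_wInf.sum_pow_Smat_mulVec wInf_Smat_mulVec wF_Tmat_mulVec,
      isMonomialInvariant_wInf.sum_pow_Tmat_mulVec wF_Tmat_mulVec wF_thirteen,
      isMonomialInvariant_dInf.sum_pow_Smat_mulVec dInf_Smat_mulVec dF_Tmat_mulVec,
      isMonomialInvariant_dInf.sum_pow_Tmat_mulVec dF_Tmat_mulVec dF_thirteen]
end
end
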